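/- For every positive integer η there is a function ηB from dimension sequences δ = (δ_1,…,δ_d) ∈ ℕ^d to the positive integers, independent of N and of K, such that for every algebraically closed field K and every finite-dimensional graded K-vector subspace V = V_1 ⊕ … ⊕ V_d of R = K[x_1,…,x_N] with dimension sequence δ, there exist an integer s ≤ ηB(δ) and forms G_1,…,G_s in R of positive degree at most d such that V is contained in the K-subalgebra K[G_1,…,G_s] of R and every sequence of K-linearly independent forms lying in the K-span of G_1,…,G_s is an R_η-sequence. -/

import Mathlib

open MvPolynomial

/-- The height of an ideal: the infimum of the heights of the prime ideals containing it
(so the unit ideal has height `⊤`). -/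
noncomputable def idealHeight {R : Type*} [CommRing R] (I : Ideal R) : ℕ∞ :=
  ⨅ (P : PrimeSpectrum R) (_ : I ≤ P.asIdeal), Order.height P

/-- A Noetherian local ring is regular if its maximal ideal is generated by
(Krull dimension)-many elements. -/
def IsRegularLocal (A : Type*) [CommRing A] [IsLocalRing A] : Prop :=
  IsNoetherianRing A ∧
    ∃ s : Finset A, Ideal.span (s : Set A) = IsLocalRing.maximalIdeal A ∧
      (s.card : WithBot ℕ∞) = ringKrullDim A

/-- Serre's condition `R_η` for a ring `A`: for every prime ideal `P` of `A` of height
at most `η`, the localization of `A` at `P` is a regular local ring. -/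
def SerreConditionR (η : ℕ) (A : Type*) [CommRing A] : Prop :=
  ∀ (P : Ideal A) [hP : P.IsPrime],
    Order.height (⟨P, hP⟩ : PrimeSpectrum A) ≤ (η : ℕ∞) →
      IsRegularLocal (Localization.AtPrime P)

/-- `G` is an `R_η`-sequence: it generates a proper ideal and the quotient of the ring by the
ideal generated by each initial segment satisfies Serre's condition `R_η`. -/
def IsRnSequence (η : ℕ) {R : Type*} [CommRing R] {s : ℕ} (G : Fin s → R) : Prop :=
  Ideal.span (Set.range G) ≠ ⊤ ∧
    ∀ i : ℕ, i ≤ s →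
      SerreConditionR η (R ⧸ Ideal.span (G '' {j : Fin s | (j : ℕ) < i}))

/-- `F`, a form of degree `d`, has a `k`-collapse: `F` lies in an ideal generated by
`k` forms of strictly smaller positive degree.  A form of degree `d` has strength at
least `s` iff it has no `s`-collapse. -/
def HasCollapse {K : Type*} [CommSemiring K] {σ : Type*} (d k : ℕ)
    (F : MvPolynomial σ K) : Prop :=
  ∃ (G : Fin k → MvPolynomial σ K) (e : Fin k → ℕ),
    (∀ i, 0 < e i ∧ e i < d ∧ (G i).IsHomogeneous (e i)) ∧
    F ∈ Ideal.span (Set.range G)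

/-- The Jacobian rows of `f` are linearly independent over the residue field of `P`. -/
def JacInd {K σ J : Type*} [CommRing K] [Fintype J] (P : Ideal (MvPolynomial σ K))
    (f : J → MvPolynomial σ K) : Prop :=
  ∀ a : J → MvPolynomial σ K, (∀ v, ∑ j, a j * pderiv v (f j) ∈ P) → ∀ j, a j ∈ P

theorem Derivation.apply_mem_of_mem_sq {K A : Type*} [CommRing K] [CommRing A] [Algebra K A]
    (D : Derivation K A A) (P : Ideal A) {x : A} (hx : x ∈ P ^ 2) : D x ∈ P := by
  rw [pow_two] at hx
  refine Submodule.mul_induction_on hx (fun a ha b hb => ?_) (fun a b ha hb => ?_)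
  · rw [D.leibniz]
    exact P.add_mem (P.mul_mem_right _ ha) (P.mul_mem_right _ hb)
  · rw [map_add]
    exact P.add_mem ha hb

section

variable {K σ J : Type*} [Field K] [Fintype J] {P : Ideal (MvPolynomial σ K)}
  [P.IsPrime] {f : J → MvPolynomial σ K}

theorem algebraMap_mem_maximalIdeal {R : Type*} [CommRing R] {P : Ideal R} [P.IsPrime] {x : R}
    (hx : x ∈ P) : algebraMap R (Localization.AtPrime P) x ∈
      IsLocalRing.maximalIdeal (Localization.AtPrime P) :=
  (IsLocalization.AtPrime.to_map_mem_maximal_iff (Localization.AtPrime P) P x).2 hx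

theorem JacInd.linearIndependent_toCotangent (h : JacInd P f) (hf : ∀ j, f j ∈ P) :
    LinearIndependent (IsLocalRing.ResidueField (Localization.AtPrime P)) fun j =>
      ((IsLocalRing.maximalIdeal (Localization.AtPrime P)).toCotangent
        ⟨algebraMap _ _ (f j), algebraMap_mem_maximalIdeal (hf j)⟩ :
        IsLocalRing.CotangentSpace (Localization.AtPrime P)) := by
  rw [Fintype.linearIndependent_iff]
  intro g hg
  choose c hc using fun j => IsLocalRing.residue_surjective (g j)
  obtain ⟨s, hs⟩ := IsLocalization.exist_integer_multiples_of_finite P.primeCompl c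
  choose a ha using hs
  have ha' : ∀ j, algebraMap _ (Localization.AtPrime P) (a j) = algebraMap _ _ (s : MvPolynomial σ K) * c j :=
    fun j => by rw [ha, Algebra.smul_def]
  have hsum : ∑ j, c j • (⟨algebraMap _ _ (f j), algebraMap_mem_maximalIdeal (hf j)⟩ :
      IsLocalRing.maximalIdeal (Localization.AtPrime P)) ∈
      LinearMap.ker (IsLocalRing.maximalIdeal (Localization.AtPrime P)).toCotangent := by
    rw [LinearMap.mem_ker, map_sum, ← hg]
    refine Finset.sum_congr rfl fun j _ => ?_
    rw [map_smul, ← hc j]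
    rfl
  rw [Ideal.mem_toCotangent_ker] at hsum
  have hsum' : algebraMap _ (Localization.AtPrime P) (∑ j, a j * f j) ∈
      (P ^ 2).map (algebraMap _ (Localization.AtPrime P)) := by
    rw [Ideal.map_pow, Localization.AtPrime.map_eq_maximalIdeal]
    have := Ideal.mul_mem_left _ (algebraMap _ (Localization.AtPrime P) (s : MvPolynomial σ K)) hsum
    convert this using 1
    simp [Finset.mul_sum, ha', mul_assoc]
  rw [IsLocalization.algebraMap_mem_map_algebraMap_iff P.primeCompl] at hsum'
  obtain ⟨t, ht, hmem⟩ := hsum'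
  have key : ∀ j, t * a j ∈ P := by
    refine h _ fun v => ?_
    have := (pderiv v).apply_mem_of_mem_sq P hmem
    rw [Finset.mul_sum, map_sum] at this
    have h2 : ∑ j, f j * pderiv v (t * a j) ∈ P :=
      P.sum_mem fun j _ => P.mul_mem_right _ (hf j)
    have := P.sub_mem this h2
    rw [← Finset.sum_sub_distrib] at this
    convert this using 2 with j
    rw [← mul_assoc, Derivation.leibniz]
    simp
  intro j
  have haj : a j ∈ P := (Ideal.IsPrime.mem_or_mem ‹_› (key j)).resolve_left ht
  rw [← hc, IsLocalRing.residue_eq_zero_iff]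
  have := algebraMap_mem_maximalIdeal haj
  rw [ha'] at this
  refine (Ideal.IsPrime.mem_or_mem inferInstance this).resolve_left ?_
  rw [IsLocalization.AtPrime.to_map_mem_maximal_iff (Localization.AtPrime P) P]
  exact s.2

variable [Finite σ]

theorem finrank_cotangentSpace_localization (P : Ideal (MvPolynomial σ K)) [P.IsPrime] :
    (Module.finrank (IsLocalRing.ResidueField (Localization.AtPrime P))
      (IsLocalRing.CotangentSpace (Localization.AtPrime P)) : ℕ∞) = P.height := by
  have : IsRegularLocalRing (Localization.AtPrime P) := inferInstance
  have h := (IsRegularLocalRing.iff_finrank_cotangentSpace _).1 this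
  rw [IsLocalization.AtPrime.ringKrullDim_eq_height P] at h
  exact_mod_cast h

theorem JacInd.card_le_height (h : JacInd P f) (hf : ∀ j, f j ∈ P) :
    (Fintype.card J : ℕ∞) ≤ P.height := by
  rw [← finrank_cotangentSpace_localization]
  exact_mod_cast (h.linearIndependent_toCotangent hf).fintype_card_le_finrank

/-- The `f j` extend to a minimal system of generators of the maximal ideal of the localization. -/
theorem JacInd.exists_span_eq_maximalIdeal (h : JacInd P f) (hf : ∀ j, f j ∈ P) {n : ℕ}
    (hn : P.height ≤ Fintype.card J + n) :
    ∃ g : Fin n → Localization.AtPrime P,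
      Ideal.span (Set.range (fun j => algebraMap _ (Localization.AtPrime P) (f j)) ∪ Set.range g) =
        IsLocalRing.maximalIdeal (Localization.AtPrime P) := by
  set A := Localization.AtPrime P
  set k := IsLocalRing.ResidueField A
  set m := IsLocalRing.maximalIdeal A
  have hli := h.linearIndependent_toCotangent hf
  set F : J → IsLocalRing.CotangentSpace A := fun j =>
      (m.toCotangent ⟨algebraMap _ _ (f j), algebraMap_mem_maximalIdeal (hf j)⟩ :) with hF
  obtain ⟨W, hW⟩ := Submodule.exists_isCompl (Submodule.span k (Set.range F))
  have hfin := Submodule.finrank_add_eq_of_isCompl hW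
  rw [finrank_span_eq_card hli] at hfin
  have hle : Module.finrank k W ≤ n := by
    have := finrank_cotangentSpace_localization P
    rw [← this] at hn
    have hn' : Module.finrank k (IsLocalRing.CotangentSpace A) ≤ Fintype.card J + n := by
      exact_mod_cast hn
    omega
  let b := Module.finBasis k W
  choose g hg using fun i => m.toCotangent_surjective (b i : IsLocalRing.CotangentSpace A)
  refine ⟨fun i => if hi : (i : ℕ) < Module.finrank k W then g ⟨i, hi⟩ else 0, ?_⟩
  have htop : Submodule.span k (m.toCotangent '' (Set.range (fun j => (⟨algebraMap _ _ (f j),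
      algebraMap_mem_maximalIdeal (hf j)⟩ : m)) ∪ Set.range g)) = ⊤ := by
    rw [Set.image_union, ← Set.range_comp, ← Set.range_comp, Submodule.span_union,
      ← hW.sup_eq_top]
    congr 1
    have : (m.toCotangent ∘ g) = fun i => W.subtype (b i) := funext hg
    erw [this]
    have h3 := congrArg (Submodule.map W.subtype) b.span_eq
    rw [Submodule.map_span, ← Set.range_comp, Submodule.map_top, Submodule.range_subtype] at h3
    exact h3
  have htop' := IsLocalRing.CotangentSpace.span_image_eq_top_iff.1 htop
  have h4 := congrArg (Submodule.map m.subtype) htop'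
  rw [Submodule.map_span, Submodule.map_top, Submodule.range_subtype, Set.image_union,
    ← Set.range_comp, ← Set.range_comp] at h4
  refine le_antisymm ?_ ?_
  · rw [Ideal.span_le]
    rintro _ (⟨j, rfl⟩ | ⟨i, rfl⟩)
    · exact algebraMap_mem_maximalIdeal (hf j)
    · dsimp only
      split_ifs with hi
      · exact (g _).2
      · exact m.zero_mem
  · conv_lhs => rw [← h4]
    refine Submodule.span_mono (Set.union_subset_union subset_rfl ?_)
    rintro _ ⟨i, rfl⟩
    exact ⟨⟨i, i.2.trans_le hle⟩, by simp⟩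

end

section
universe u
variable {K : Type u} [Field K] {N : ℕ}

theorem Ideal.height_comap_le_of_surjective {R B : Type*} [CommRing R] [IsNoetherianRing R]
    [CommRing B] {π : R →+* B} (hπ : Function.Surjective π) (Q : Ideal B) [Q.IsPrime] :
    (Q.comap π).height ≤ Q.height + (RingHom.ker π).spanFinrank := by
  have hIP : RingHom.ker π ≤ Q.comap π := fun x hx => by
    rw [Ideal.mem_comap, RingHom.mem_ker.1 hx]
    exact Q.zero_mem
  have := Ideal.height_le_height_add_spanFinrank_of_le hIP
  set e := RingHom.quotientKerEquivOfSurjective hπ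
  have h2 : Ideal.map (Ideal.Quotient.mk (RingHom.ker π)) (Q.comap π) =
      Q.comap (e : R ⧸ RingHom.ker π →+* B) := by
    rw [← Ideal.map_comap_of_surjective (Ideal.Quotient.mk (RingHom.ker π))
      Ideal.Quotient.mk_surjective (Q.comap (e : R ⧸ RingHom.ker π →+* B)), Ideal.comap_comap]
    rfl
  rw [h2] at this
  exact this.trans_eq (congrArg (· + _) (RingEquiv.height_comap e Q))

theorem JacInd.isRegularLocal {J : Type*} [Fintype J] {f : J → MvPolynomial (Fin N) K}
    {B : Type u} [CommRing B] (π : MvPolynomial (Fin N) K →+* B) (hπ : Function.Surjective π)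
    (hI : RingHom.ker π = Ideal.span (Set.range f)) (Q : Ideal B) [Q.IsPrime]
    (h : JacInd (Q.comap π) f) :
    IsRegularLocal (Localization.AtPrime Q) := by
  set P := Q.comap π
  set I := RingHom.ker π
  have hIP : I ≤ P := by
    intro x hx
    rw [Ideal.mem_comap, RingHom.mem_ker.1 hx]
    exact Q.zero_mem
  have hf : ∀ j, f j ∈ P := fun j => hIP (hI ▸ Ideal.subset_span ⟨j, rfl⟩)
  have hsurj := RingHom.surjective_localRingHom_of_surjective π
    hπ Q
  have hPfin : P.height ≠ ⊤ := by
    rw [← finrank_cotangentSpace_localization P]; exact ENat.natCast_ne_top _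
  have hcard := h.card_le_height hf
  obtain ⟨n, hn⟩ := ENat.ne_top_iff_exists.1 hPfin
  obtain ⟨r, hr⟩ : ∃ r, n = Fintype.card J + r := by
    rw [← hn] at hcard
    exact Nat.exists_eq_add_of_le (by exact_mod_cast hcard)
  obtain ⟨g, hg⟩ := h.exists_span_eq_maximalIdeal hf (n := r) (by rw [← hn, hr]; simp)
  set φ := Localization.localRingHom P Q π rfl
  have hmax : Ideal.span (Set.range (φ ∘ g)) =
      IsLocalRing.maximalIdeal (Localization.AtPrime Q) := by
    have hmap : (IsLocalRing.maximalIdeal (Localization.AtPrime P)).map φ =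
        IsLocalRing.maximalIdeal (Localization.AtPrime Q) := by
      have := IsLocalHom.of_surjective φ hsurj
      rw [← IsLocalRing.maximalIdeal_comap φ, Ideal.map_comap_of_surjective φ hsurj]
    rw [← hmap, ← hg, Ideal.map_span, Set.image_union,
      Ideal.span_union, ← Set.range_comp, ← Set.range_comp]
    symm
    rw [sup_eq_right]
    rw [Ideal.span_le]
    rintro _ ⟨j, rfl⟩
    have : φ (algebraMap _ (Localization.AtPrime P) (f j)) = 0 := by
      rw [Localization.localRingHom_to_map, show π (f j) = 0 from RingHom.mem_ker.1
        (hI.symm ▸ Ideal.subset_span ⟨j, rfl⟩ : f j ∈ I), map_zero]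
    simp [this]
  have hNoeth : IsNoetherianRing (Localization.AtPrime Q) := by
    have := isNoetherianRing_of_surjective _ _ π hπ
    exact IsLocalization.isNoetherianRing Q.primeCompl _ inferInstance
  have hdim : ((IsLocalRing.maximalIdeal (Localization.AtPrime Q)).spanFinrank : WithBot ℕ∞) =
      ringKrullDim (Localization.AtPrime Q) := by
    refine le_antisymm ?_ (ringKrullDim_le_spanFinrank_maximalIdeal _)
    rw [IsLocalization.AtPrime.ringKrullDim_eq_height Q]
    have h1 : (IsLocalRing.maximalIdeal (Localization.AtPrime Q)).spanFinrank ≤ r := by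
      rw [← hmax]
      refine (Submodule.spanFinrank_span_le_ncard_of_finite (Set.finite_range _)).trans ?_
      rw [← Set.image_univ]
      refine (Set.ncard_image_le Set.finite_univ).trans ?_
      simp
    have h2 := Ideal.height_comap_le_of_surjective hπ Q
    have h3 : I.spanFinrank ≤ Fintype.card J := by
      rw [hI]
      refine (Submodule.spanFinrank_span_le_ncard_of_finite (Set.finite_range _)).trans ?_
      rw [← Set.image_univ]
      refine (Set.ncard_image_le Set.finite_univ).trans ?_
      simp
    have h4 : (r : ℕ∞) ≤ Q.height := by
      rw [← hn, hr] at h2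
      have h5 : ((Fintype.card J + r : ℕ) : ℕ∞) ≤ Q.height + Fintype.card J :=
        h2.trans (by gcongr)
      rw [add_comm, Nat.cast_add] at h5
      exact (ENat.add_le_add_iff_right (ENat.natCast_ne_top _)).1 h5
    have h5 : ((IsLocalRing.maximalIdeal (Localization.AtPrime Q)).spanFinrank : ℕ∞) ≤ Q.height :=
      le_trans (by exact_mod_cast h1) h4
    exact_mod_cast h5
  refine ⟨hNoeth, ?_⟩
  obtain ⟨s, hs, hs'⟩ := Submodule.FG.exists_span_finset_card_eq_spanFinrank
    (IsNoetherian.noetherian (IsLocalRing.maximalIdeal (Localization.AtPrime Q)))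
  exact ⟨s, hs', by rw [hs, hdim]⟩
end

section
variable {L : Type*} [Field L] (p : ℕ) [Fact p.Prime] [CharP L p]

theorem minpoly_eq_X_pow_sub_C_of_notMem {E : Subfield L} (hE : ∀ y : L, y ^ p ∈ E) {y : L}
    (hy : y ∉ E) : minpoly E y = Polynomial.X ^ p - Polynomial.C ⟨y ^ p, hE y⟩ := by
  symm
  refine minpoly.eq_of_irreducible_of_monic ?_ (by simp [Subfield.algebraMap_ofSubfield])
    (Polynomial.monic_X_pow_sub_C _ (Fact.out : p.Prime).ne_zero)
  refine X_pow_sub_C_irreducible_of_prime Fact.out fun b hb => hy ?_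
  have : (b : L) ^ p = y ^ p := congrArg Subtype.val hb
  have := frobenius_inj L p this
  exact this ▸ b.2

theorem finrank_adjoin_eq_of_notMem {E : Subfield L} (hE : ∀ y : L, y ^ p ∈ E) {y : L}
    (hy : y ∉ E) : Module.finrank E (IntermediateField.adjoin E {y}) = p := by
  have hint : IsIntegral E y := by
    refine IsIntegral.of_pow (Fact.out : p.Prime).pos ?_
    exact (isIntegral_algebraMap (R := E) (x := ⟨y ^ p, hE y⟩))
  rw [IntermediateField.adjoin.finrank hint, minpoly_eq_X_pow_sub_C_of_notMem p hE hy,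
    Polynomial.natDegree_X_pow_sub_C]

theorem exists_subfield_maximal_notMem {x : L} (hx : ∀ y, y ^ p ≠ x) :
    ∃ E : Subfield L, (∀ y : L, y ^ p ∈ E) ∧ x ∉ E ∧ ∀ y, y ∉ E →
      x ∈ IntermediateField.adjoin E {y} := by
  obtain ⟨E, hle, hmax⟩ := zorn_le_nonempty₀ {E : Subfield L | (∀ y : L, y ^ p ∈ E) ∧ x ∉ E}
    (fun c hc hchain y hy => by
      refine ⟨sSup c, ⟨fun z => ?_, fun hxc => ?_⟩, fun z hz => le_sSup hz⟩
      · exact (le_sSup hy : y ≤ sSup c) ((hc hy).1 z)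
      · obtain ⟨s, hs, hxs⟩ := (Subfield.mem_sSup_of_directedOn ⟨y, hy⟩ hchain.directedOn).1 hxc
        exact (hc hs).2 hxs) (frobenius L p).fieldRange
    ⟨fun y => ⟨y, rfl⟩, fun ⟨y, hy⟩ => hx y hy⟩
  refine ⟨E, hmax.prop.1, hmax.prop.2, fun y hy => ?_⟩
  by_contra hcon
  have hle : E ≤ (IntermediateField.adjoin E {y}).toSubfield := fun z hz =>
    (IntermediateField.adjoin E {y}).algebraMap_mem (⟨z, hz⟩ : E)
  have := hmax.le_of_ge (y := (IntermediateField.adjoin E {y}).toSubfield)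
    ⟨fun z => hle (hmax.prop.1 z), hcon⟩ hle
  exact hy (this (IntermediateField.mem_adjoin_simple_self E y))

theorem exists_derivation_ne_zero {x : L} (hx : ∀ y, y ^ p ≠ x) :
    ∃ E : Subfield L, (∀ y : L, y ^ p ∈ E) ∧ KaehlerDifferential.D E L x ≠ 0 := by
  obtain ⟨E, hE, hxE, hmax⟩ := exists_subfield_maximal_notMem p hx
  refine ⟨E, hE, fun hD => ?_⟩
  have hint : IsIntegral E x := by
    refine IsIntegral.of_pow (Fact.out : p.Prime).pos ?_
    exact (isIntegral_algebraMap (R := E) (x := ⟨x ^ p, hE x⟩))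
  have htop : IntermediateField.adjoin E {x} = ⊤ := by
    rw [eq_top_iff]
    intro y _
    by_cases hy : y ∈ E
    · exact (IntermediateField.adjoin E {x}).algebraMap_mem (⟨y, hy⟩ : E)
    · have hle : IntermediateField.adjoin E {x} ≤ IntermediateField.adjoin E {y} := by
        rw [IntermediateField.adjoin_simple_le_iff]
        exact hmax y hy
      have hinty : IsIntegral E y := by
        refine IsIntegral.of_pow (Fact.out : p.Prime).pos ?_
        exact (isIntegral_algebraMap (R := E) (x := ⟨y ^ p, hE y⟩))
      have := IntermediateField.adjoin.finiteDimensional hinty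
      have := IntermediateField.eq_of_le_of_finrank_eq hle
        ((finrank_adjoin_eq_of_notMem p hE hxE).trans (finrank_adjoin_eq_of_notMem p hE hy).symm)
      rw [this]
      exact IntermediateField.mem_adjoin_simple_self E y
  have hfin : FiniteDimensional E L := by
    have := IntermediateField.adjoin.finiteDimensional hint
    rw [htop] at this
    exact Module.Finite.equiv (IntermediateField.topEquiv (F := E) (E := L)).toLinearEquiv
  have hzero : ∀ y : L, KaehlerDifferential.D E L y = 0 := by
    intro y
    have hy : y ∈ Algebra.adjoin E {x} := by
      rw [← IntermediateField.adjoin_simple_toSubalgebra_of_isAlgebraic hint.isAlgebraic, htop]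
      trivial
    have := Derivation.eqOn_adjoin (D1 := KaehlerDifferential.D E L) (D2 := 0) (s := {x})
      (by intro z hz; rw [Set.mem_singleton_iff.1 hz, hD]; rfl) hy
    exact this
  have hsub : Subsingleton (Ω[L⁄E]) := by
    rw [← Submodule.subsingleton_iff L, ← subsingleton_iff_bot_eq_top,
      ← KaehlerDifferential.span_range_derivation, eq_comm, Submodule.span_eq_bot]
    rintro _ ⟨y, rfl⟩
    exact hzero y
  have hunr : Algebra.FormallyUnramified E L := ⟨hsub⟩
  have hsep := (Algebra.FormallyUnramified.iff_isSeparable E L).1 hunr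
  have hsep' := hsep.isSeparable' x
  rw [IsSeparable, minpoly_eq_X_pow_sub_C_of_notMem p hE hxE] at hsep'
  have hder := (Polynomial.separable_def _).1 hsep'
  have hp0 : (p : E) = 0 := by
    apply Subtype.ext
    simp
  rw [Polynomial.derivative_sub, Polynomial.derivative_X_pow, Polynomial.derivative_C, sub_zero,
    hp0, map_zero, zero_mul, isCoprime_zero_right] at hder
  have := Polynomial.natDegree_eq_zero_of_isUnit hder
  rw [Polynomial.natDegree_X_pow_sub_C] at this
  exact (Fact.out : p.Prime).ne_zero this

end

theorem exists_pow_mul_sub_pow_mem {K σ : Type*} [Field K] [Fintype σ] (p : ℕ) [Fact p.Prime]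
    [CharP K p] [PerfectRing K p] (Q : Ideal (MvPolynomial σ K)) [Q.IsPrime] {F : MvPolynomial σ K}
    (hF : ∀ v, pderiv v F ∈ Q) : ∃ a b, b ∉ Q ∧ b ^ p * F - a ^ p ∈ Q := by
  let A := MvPolynomial σ K ⧸ Q
  let L := FractionRing A
  let φ : MvPolynomial σ K →ₐ[K] L := (IsScalarTower.toAlgHom K A L).comp (Ideal.Quotient.mkₐ K Q)
  have hφ : ∀ x, φ x = algebraMap A L (Ideal.Quotient.mk Q x) := fun x => rfl
  have hφ0 : ∀ x, φ x = 0 ↔ x ∈ Q := fun x => by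
    rw [hφ, FaithfulSMul.algebraMap_eq_zero_iff, Ideal.Quotient.eq_zero_iff_mem]
  have hchar : CharP L p := charP_of_injective_algebraMap (algebraMap K L).injective p
  by_cases hx : ∃ y : L, y ^ p = φ F
  · obtain ⟨y, hy⟩ := hx
    obtain ⟨a, b, hb, rfl⟩ := IsFractionRing.div_surjective (A := A) y
    obtain ⟨a, rfl⟩ := Ideal.Quotient.mk_surjective a
    obtain ⟨b, rfl⟩ := Ideal.Quotient.mk_surjective b
    have hbQ : b ∉ Q := fun h => nonZeroDivisors.ne_zero hb (Ideal.Quotient.eq_zero_iff_mem.2 h)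
    refine ⟨a, b, hbQ, ?_⟩
    rw [← hφ0, map_sub, map_mul, map_pow, map_pow, ← hy, ← hφ, ← hφ]
    have : φ b ≠ 0 := fun h => hbQ ((hφ0 b).1 h)
    rw [div_pow, mul_div_cancel₀ _ (pow_ne_zero _ this), sub_self]
  · push Not at hx
    exfalso
    obtain ⟨E, hE, hD⟩ := exists_derivation_ne_zero p hx
    apply hD
    have hK : ∀ c : K, algebraMap K L c ∈ E := fun c => by
      obtain ⟨b, rfl⟩ := (PerfectRing.bijective_frobenius (R := K) (p := p)).2 c
      show algebraMap K L (b ^ p) ∈ E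
      rw [map_pow]
      exact hE _
    have key : ∀ G : MvPolynomial σ K, KaehlerDifferential.D E L (φ G) =
        ∑ v, φ (pderiv v G) • KaehlerDifferential.D E L (φ (X v)) := by
      classical
      intro G
      induction G using MvPolynomial.induction_on with
      | C c =>
        have h1 : φ (C c) = algebraMap E L ⟨algebraMap K L c, hK c⟩ := φ.commutes c
        rw [h1, Derivation.map_algebraMap]
        simp
      | add G H hG hH => simp [hG, hH, add_smul, Finset.sum_add_distrib]
      | mul_X G v hG =>
        rw [map_mul, Derivation.leibniz, hG, Finset.smul_sum]
        simp only [Derivation.leibniz, smul_eq_mul, map_add, map_mul, add_smul,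
          Finset.sum_add_distrib, pderiv_X, mul_smul]
        simp [Pi.single_apply, apply_ite φ, ite_smul]
    rw [key]
    exact Finset.sum_eq_zero fun v _ => by rw [(hφ0 _).2 (hF v), zero_smul]

section Depth

variable {A : Type*} [CommRing A]

/-- `x` is a nonzerodivisor modulo `I`. -/
def RegMod (I : Ideal A) (x : A) : Prop := ∀ a, x * a ∈ I → a ∈ I

/-- `P` is an associated prime of `A ⧸ I`. -/
def AssMod (I P : Ideal A) : Prop := P.IsPrime ∧ ∃ c, ∀ r, r ∈ P ↔ r * c ∈ I

theorem assMod_iff [IsNoetherianRing A] {I P : Ideal A} :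
    AssMod I P ↔ P ∈ associatedPrimes A (A ⧸ I) := by
  rw [AssociatedPrimes.mem_iff, isAssociatedPrime_iff, AssMod]
  refine and_congr_right fun _ => ?_
  rw [Ideal.Quotient.mk_surjective.exists]
  refine exists_congr fun c => ?_
  rw [Ideal.ext_iff]
  refine forall_congr' fun r => ?_
  rw [Submodule.mem_colon_singleton, Submodule.mem_bot,
    ← Ideal.Quotient.eq_zero_iff_mem (a := r * c), map_mul]
  rfl

theorem finite_assMod [IsNoetherianRing A] (I : Ideal A) : {P | AssMod I P}.Finite := by
  simp_rw [assMod_iff]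
  exact associatedPrimes.finite A _

theorem exists_assMod [IsNoetherianRing A] {I : Ideal A} {c : A} (hc : c ∉ I) :
    ∃ P, AssMod I P ∧ ∀ r, r * c ∈ I → r ∈ P := by
  obtain ⟨P, hP, hle⟩ := exists_le_isAssociatedPrime_of_isNoetherianRing A
    (Ideal.Quotient.mk I c) (fun h => hc (Ideal.Quotient.eq_zero_iff_mem.1 h))
  refine ⟨P, assMod_iff.2 hP, fun r hr => hle ?_⟩
  rw [Submodule.mem_colon_singleton, Submodule.mem_bot]
  exact Ideal.Quotient.eq_zero_iff_mem.2 hr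

theorem AssMod.notMem_of_regMod {I P : Ideal A} (h : AssMod I P) {x : A} (hx : RegMod I x) :
    x ∉ P := by
  obtain ⟨hP, c, hc⟩ := h
  intro hxP
  refine hP.ne_top ((Ideal.eq_top_iff_one _).2 ((hc 1).2 ?_))
  rw [one_mul]
  exact hx _ ((hc x).1 hxP)

theorem regMod_of_forall_notMem [IsNoetherianRing A] {I : Ideal A} {x : A}
    (h : ∀ P, AssMod I P → x ∉ P) : RegMod I x := by
  intro a ha
  by_contra hc
  obtain ⟨P, hP, hP'⟩ := exists_assMod hc
  exact h P hP (hP' x ha)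

theorem exists_regMod_of_forall_not_le [IsNoetherianRing A] {I I' D : Ideal A}
    (h : ∀ P, AssMod I P → ¬ D ≤ P) (h' : ∀ P, AssMod I' P → ¬ D ≤ P) :
    ∃ x ∈ D, RegMod I x ∧ RegMod I' x := by
  have hfin := (finite_assMod I).union (finite_assMod I')
  by_contra! hcon
  have hsub : (D : Set A) ⊆ ⋃ P ∈ ({P | AssMod I P} ∪ {P | AssMod I' P}), (P : Set A) := by
    intro x hx
    simp only [Set.mem_iUnion, SetLike.mem_coe]
    by_contra! hno
    exact hcon x hx (regMod_of_forall_notMem fun P hP => hno P (Or.inl hP))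
      (regMod_of_forall_notMem fun P hP => hno P (Or.inr hP))
  obtain ⟨P, hP, hle⟩ := (Ideal.subset_union_prime_finite hfin (f := id) ⊥ ⊥ (by
    rintro P (hP | hP) _ _ <;> exact hP.1)).1 hsub
  exact hP.elim (fun hP => h P hP hle) (fun hP => h' P hP hle)

theorem mem_sup_span_singleton' {I : Ideal A} {x a : A} :
    a ∈ I ⊔ Ideal.span {x} ↔ ∃ b, a - x * b ∈ I := by
  rw [Submodule.mem_sup]
  constructor
  · rintro ⟨i, hi, y, hy, rfl⟩
    obtain ⟨b, rfl⟩ := Ideal.mem_span_singleton'.1 hy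
    exact ⟨b, by convert hi using 1; ring⟩
  · rintro ⟨b, hb⟩
    exact ⟨_, hb, x * b, Ideal.mul_mem_right _ _ (Ideal.mem_span_singleton_self x), by ring⟩

theorem RegMod.sup_swap {I : Ideal A} {x z : A}
    (hx : RegMod I x) (hz : RegMod (I ⊔ Ideal.span {x}) z) : RegMod (I ⊔ Ideal.span {z}) x := by
  intro a ha
  obtain ⟨b, hb⟩ := mem_sup_span_singleton'.1 ha
  obtain ⟨c, hc⟩ := mem_sup_span_singleton'.1 (hz b (mem_sup_span_singleton'.2 ⟨a, by
    rw [← neg_mem_iff]; convert hb using 1; ring⟩))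
  refine mem_sup_span_singleton'.2 ⟨c, hx _ ?_⟩
  have := I.add_mem hb (I.mul_mem_left z hc)
  convert this using 1
  ring

variable [IsLocalRing A]

open IsLocalRing

/-- There is a regular sequence of length `n` on `A ⧸ I` in the maximal ideal. -/
def DepthGE : ℕ → Ideal A → Prop
  | 0, _ => True
  | n + 1, I => ∃ x ∈ maximalIdeal A, RegMod I x ∧ DepthGE n (I ⊔ Ideal.span {x})

theorem le_of_le_sup_mul [IsNoetherianRing A] {I Z : Ideal A} {x : A} (hx : x ∈ maximalIdeal A)
    (h : ∀ a ∈ Z, ∃ b ∈ Z, a - x * b ∈ I) : Z ≤ I := by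
  refine Submodule.le_of_le_smul_of_le_jacobson_bot (I := maximalIdeal A)
    (IsNoetherian.noetherian Z) (IsLocalRing.maximalIdeal_le_jacobson _) ?_
  intro a ha
  obtain ⟨b, hb, hab⟩ := h a ha
  rw [← sub_add_cancel a (x * b)]
  exact Submodule.add_mem_sup hab (Ideal.mul_mem_mul hx hb)

theorem RegMod.of_sup [IsNoetherianRing A] {I : Ideal A} {x z : A} (hxm : x ∈ maximalIdeal A)
    (hx : RegMod I x) (hz : RegMod (I ⊔ Ideal.span {x}) z) : RegMod I z := by
  have : I.colon {z} ≤ I := by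
    refine le_of_le_sup_mul hxm fun a ha => ?_
    rw [Submodule.mem_colon_singleton, smul_eq_mul] at ha
    obtain ⟨b, hb⟩ := mem_sup_span_singleton'.1
      (hz a (Submodule.mem_sup_left (mul_comm a z ▸ ha)))
    refine ⟨b, ?_, hb⟩
    rw [Submodule.mem_colon_singleton, smul_eq_mul]
    refine hx _ ?_
    have := I.sub_mem ha (I.mul_mem_left z hb)
    convert this using 1
    ring
  intro a ha
  refine this ?_
  rw [Submodule.mem_colon_singleton, smul_eq_mul, mul_comm]
  exact ha

theorem not_le_of_regMod {I P : Ideal A} {x : A} (hx : x ∈ maximalIdeal A) (hxI : RegMod I x)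
    (hP : AssMod I P) : ¬ maximalIdeal A ≤ P := fun h => hP.notMem_of_regMod hxI (h hx)

theorem not_le_of_forall {I P : Ideal A} (h : ∀ c, (∀ r ∈ maximalIdeal A, r * c ∈ I) → c ∈ I)
    (hP : AssMod I P) : ¬ maximalIdeal A ≤ P := by
  obtain ⟨hp, c, hc⟩ := hP
  intro hle
  refine hp.ne_top ((Ideal.eq_top_iff_one _).2 ((hc 1).2 ?_))
  rw [one_mul]
  exact h c fun r hr => (hc r).1 (hle hr)

theorem DepthGE.sup_span [IsNoetherianRing A] {n : ℕ} {I : Ideal A} (h : DepthGE (n + 1) I) {y : A}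
    (hym : y ∈ maximalIdeal A) (hy : RegMod I y) : DepthGE n (I ⊔ Ideal.span {y}) := by
  induction n generalizing I y with
  | zero => trivial
  | succ k ih =>
    obtain ⟨x, hxm, hx, hdep⟩ := h
    have hxw := hdep
    obtain ⟨w, hwm, hw, -⟩ := hxw
    obtain ⟨z, hzm, hzx, hzy⟩ := exists_regMod_of_forall_not_le (D := maximalIdeal A)
      (I := I ⊔ Ideal.span {x}) (I' := I ⊔ Ideal.span {y})
      (fun P hP => not_le_of_regMod hwm hw hP) (fun P hP => not_le_of_forall (fun c hc => by
        obtain ⟨b, hb⟩ := mem_sup_span_singleton'.1 (hc x hxm)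
        have hwb : b ∈ I ⊔ Ideal.span {x} := by
          refine hw _ ?_
          obtain ⟨e, he⟩ := mem_sup_span_singleton'.1 (hc w hwm)
          refine mem_sup_span_singleton'.2 ⟨e, hy _ ?_⟩
          have := I.sub_mem (I.mul_mem_left x he) (I.mul_mem_left w hb)
          convert this using 1
          ring
        obtain ⟨b', hb'⟩ := mem_sup_span_singleton'.1 hwb
        refine mem_sup_span_singleton'.2 ⟨b', hx _ ?_⟩
        have := I.add_mem hb (I.mul_mem_left y hb')
        convert this using 1
        ring) hP)
    have h1 := ih hdep hzm hzx
    have hz : RegMod I z := hx.of_sup hxm hzx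
    have h2 : DepthGE (k + 1) (I ⊔ Ideal.span {z}) :=
      ⟨x, hxm, hx.sup_swap hzx, by rwa [sup_right_comm] at h1⟩
    have h3 := ih h2 hym (hy.sup_swap hzy)
    exact ⟨z, hzm, hzy, by rwa [sup_right_comm] at h3⟩

theorem AssMod.height_add_le [IsNoetherianRing A] {n : ℕ} {I P : Ideal A} (hP : AssMod I P)
    (h : DepthGE n I) : P.height + n ≤ (maximalIdeal A).height := by
  induction n generalizing I P with
  | zero => simpa using Ideal.height_mono (le_maximalIdeal hP.1.ne_top)
  | succ n ih =>
    obtain ⟨x, hxm, hx, hdep⟩ := h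
    have hxP := hP.notMem_of_regMod hx
    obtain ⟨hprime, c, hc⟩ := hP
    have hcI : c ∉ I := fun h => hprime.ne_top ((Ideal.eq_top_iff_one _).2 ((hc 1).2 (by simpa)))
    obtain ⟨a, haP, ha⟩ : ∃ a, (∀ r ∈ P, r * a ∈ I) ∧ a ∉ I ⊔ Ideal.span {x} := by
      by_contra! hcon
      let Z : Ideal A :=
        { carrier := {a | ∀ r ∈ P, r * a ∈ I}
          add_mem' := fun ha hb r hr => by rw [mul_add]; exact I.add_mem (ha r hr) (hb r hr)
          zero_mem' := fun r _ => by simp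
          smul_mem' := fun s a ha r hr => by
            rw [smul_eq_mul, mul_left_comm]; exact I.mul_mem_left _ (ha r hr) }
      have hZ : Z ≤ I := le_of_le_sup_mul hxm fun a ha => by
        obtain ⟨b, hb⟩ := mem_sup_span_singleton'.1 (hcon a ha)
        refine ⟨b, fun r hr => hx _ ?_, hb⟩
        have := I.sub_mem (ha r hr) (I.mul_mem_left r hb)
        convert this using 1
        ring
      exact hcI (hZ fun r hr => (hc r).1 hr)
    obtain ⟨P', hP', hle⟩ := exists_assMod ha
    have hlt : P < P' := lt_of_le_of_ne
      (fun r hr => hle r (Submodule.mem_sup_left (haP r hr)))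
      (fun heq => hxP (heq ▸ hle x (Submodule.mem_sup_right (Ideal.mul_mem_right _ _
        (Ideal.mem_span_singleton_self x)))))
    have h1 := ih hP' hdep
    have := hP'.1
    have h2 := Ideal.height_add_one_le_of_lt_of_isPrime hlt
    calc P.height + ((n + 1 : ℕ) : ℕ∞) = (P.height + 1) + n := by push_cast; ring
      _ ≤ P'.height + n := by gcongr
      _ ≤ _ := h1

end Depth

theorem JacInd.comp_injective {K σ J J' : Type*} [CommRing K] [Fintype J] [Fintype J']
    {P : Ideal (MvPolynomial σ K)} {f : J → MvPolynomial σ K} (h : JacInd P f) {e : J' → J}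
    (he : Function.Injective e) : JacInd P (f ∘ e) := by
  classical
  intro a ha j
  have := h (Function.extend e a 0) (fun v => ?_) (e j)
  · rwa [he.extend_apply] at this
  · convert ha v using 1
    rw [← Finset.sum_subset (Finset.subset_univ (Finset.univ.image e)),
      Finset.sum_image fun _ _ _ _ h => he h]
    · simp [he.extend_apply]
    · intro j _ hj
      rw [Function.extend_apply', Pi.zero_apply, zero_mul]
      rintro ⟨i, rfl⟩
      simp at hj

theorem RegMod.map {R : Type*} [CommRing R] (M : Submonoid R) (A : Type*) [CommRing A]
    [Algebra R A] [IsLocalization M A] {I : Ideal R} {x : R} (h : RegMod I x) :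
    RegMod (I.map (algebraMap R A)) (algebraMap R A x) := by
  intro a ha
  obtain ⟨b, s, rfl⟩ := IsLocalization.exists_mk'_eq M a
  rw [← IsLocalization.mk'_one (M := M) A x, ← IsLocalization.mk'_mul,
    IsLocalization.mk'_mem_map_algebraMap_iff] at ha
  rw [IsLocalization.mk'_mem_map_algebraMap_iff]
  obtain ⟨t, ht, hmem⟩ := ha
  exact ⟨t, ht, h _ (by rwa [mul_left_comm])⟩

section

variable {K : Type*} [Field K] {N : ℕ}

theorem regMod_span_X {s : Set (Fin N)} {k : Fin N} (hk : k ∉ s) :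
    RegMod (Ideal.span (X '' s : Set (MvPolynomial (Fin N) K))) (X k) := by
  classical
  intro a ha
  rw [mem_ideal_span_X_image] at ha ⊢
  intro m hm
  obtain ⟨i, hi, hmi⟩ := ha (Finsupp.single k 1 + m) (by
    rw [mem_support_iff, coeff_X_mul]
    exact mem_support_iff.1 hm)
  refine ⟨i, hi, ?_⟩
  have : k ≠ i := fun h => hk (h ▸ hi)
  simpa [Finsupp.single_apply, this] using hmi

instance isPrime_ker_constantCoeff :
    (RingHom.ker (constantCoeff (R := K) (σ := Fin N))).IsPrime := RingHom.ker_isPrime _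

variable (K N) in
/-- The local ring of affine space at the origin. -/
abbrev OriginRing := Localization.AtPrime (RingHom.ker (constantCoeff (R := K) (σ := Fin N)))

variable (K N) in
theorem ker_constantCoeff_eq :
    RingHom.ker (constantCoeff (R := K) (σ := Fin N)) = Ideal.span (Set.range X) := by
  ext x
  rw [← Set.image_univ, mem_ideal_span_X_image, RingHom.mem_ker]
  constructor
  · intro h m hm
    by_contra! hcon
    have : m = 0 := by ext i; simpa using hcon i
    subst this
    exact mem_support_iff.1 hm h
  · intro h
    by_contra hcon
    obtain ⟨i, -, hi⟩ := h 0 (mem_support_iff.2 hcon)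
    exact hi rfl

variable (K N) in
theorem height_ker_constantCoeff_le :
    (RingHom.ker (constantCoeff (R := K) (σ := Fin N))).height ≤ N := by
  refine (Ideal.height_le_spanFinrank _ (RingHom.ker_ne_top _)).trans ?_
  rw [ker_constantCoeff_eq]
  have := Submodule.spanFinrank_span_le_ncard_of_finite (R := MvPolynomial (Fin N) K)
    (Set.finite_range (X : Fin N → MvPolynomial (Fin N) K))
  have h2 : (Set.range (X : Fin N → MvPolynomial (Fin N) K)).ncard ≤ N := by
    rw [← Set.image_univ]
    exact (Set.ncard_image_le Set.finite_univ).trans (by simp)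
  exact_mod_cast this.trans h2

theorem depthGE_span_X (n : ℕ) (s : Finset (Fin N)) (h : n + s.card = N) :
    DepthGE n ((Ideal.span (X '' (s : Set (Fin N)) : Set (MvPolynomial (Fin N) K))).map
      (algebraMap _ (OriginRing K N))) := by
  induction n generalizing s with
  | zero => trivial
  | succ n ih =>
    obtain ⟨k, hk⟩ : ∃ k, k ∉ s := by
      by_contra! hcon
      have : s = Finset.univ := Finset.eq_univ_iff_forall.2 hcon
      simp [this] at h
    refine ⟨algebraMap _ _ (X k), algebraMap_mem_maximalIdeal (by simp [RingHom.mem_ker]),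
      (regMod_span_X (by simpa using hk)).map
        (RingHom.ker (constantCoeff (R := K) (σ := Fin N))).primeCompl _, ?_⟩
    have := ih (insert k s) (by rw [Finset.card_insert_of_notMem hk]; omega)
    rwa [Finset.coe_insert, Set.image_insert_eq, Ideal.span_insert, sup_comm, Ideal.map_sup,
      Ideal.map_span _ {X k}, Set.image_singleton] at this

variable (K N) in
theorem depthGE_originRing : DepthGE N (⊥ : Ideal (OriginRing K N)) := by
  simpa using depthGE_span_X (K := K) N ∅ (by simp)

theorem AssMod.height_comap_le {I P : Ideal (OriginRing K N)} (hP : AssMod I P) {n i : ℕ}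
    (h : DepthGE n I) (hn : n + i = N) : (P.comap (algebraMap (MvPolynomial (Fin N) K) _)).height ≤ i := by
  have h1 := hP.height_add_le h
  have h2 := IsLocalization.height_under
    (RingHom.ker (constantCoeff (R := K) (σ := Fin N))).primeCompl P
  have h3 := IsLocalization.height_under
    (RingHom.ker (constantCoeff (R := K) (σ := Fin N))).primeCompl
    (IsLocalRing.maximalIdeal (OriginRing K N))
  have h4 : (IsLocalRing.maximalIdeal (OriginRing K N)).under (MvPolynomial (Fin N) K) =
      RingHom.ker (constantCoeff (R := K) (σ := Fin N)) :=
    Localization.AtPrime.under_maximalIdeal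
  rw [h4] at h3
  have h5 : P.height + n ≤ i + n := by
    refine (h1.trans (h3.symm.le.trans (height_ker_constantCoeff_le K N))).trans ?_
    rw [add_comm]
    exact_mod_cast hn.ge
  exact h2.le.trans ((ENat.add_le_add_iff_right (ENat.natCast_ne_top n)).1 h5)

variable {r : ℕ} {y : Fin r → MvPolynomial (Fin N) K}

theorem JacInd.regMod_map {i : Fin r}
    (hJ : ∀ P : Ideal (MvPolynomial (Fin N) K), P.IsPrime → P.height ≤ r → JacInd P y)
    {n : ℕ} (h : DepthGE n ((Ideal.span (y '' {j | j < i})).map (algebraMap _ (OriginRing K N))))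
    (hn : n + i = N) :
    RegMod ((Ideal.span (y '' {j | j < i})).map (algebraMap _ (OriginRing K N)))
      (algebraMap _ _ (y i)) := by
  refine regMod_of_forall_notMem fun P hP hyP => ?_
  have hht := hP.height_comap_le h hn
  have hprime := hP.1
  have hJ' := (hJ (P.comap (algebraMap _ _)) inferInstance
    (hht.trans (by exact_mod_cast i.2.le))).comp_injective (e := fun j : Fin (i + 1) =>
      (⟨j, by omega⟩ : Fin r)) (fun a b hab => by simpa [Fin.ext_iff] using hab)
  have := hJ'.card_le_height (fun j => ?_)
  · have := this.trans hht
    rw [Fintype.card_fin] at this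
    exact absurd (show ((i : ℕ) + 1 ≤ i) by exact_mod_cast this) (by omega)
  · rcases Nat.lt_succ_iff_lt_or_eq.1 j.2 with hj | hj
    · obtain ⟨hp, c, hc⟩ := hP
      refine (hc _).2 (Ideal.mul_mem_right _ _ (Ideal.mem_map_of_mem _ (Ideal.subset_span ⟨_, ?_, rfl⟩)))
      exact hj
    · have hji : (⟨j, by omega⟩ : Fin r) = i := Fin.ext hj
      show algebraMap _ _ (y ⟨j, _⟩) ∈ P
      rwa [hji]

theorem JacInd.depthGE_map (h0 : ∀ j, constantCoeff (y j) = 0)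
    (hJ : ∀ P : Ideal (MvPolynomial (Fin N) K), P.IsPrime → P.height ≤ r → JacInd P y)
    (i : ℕ) (hi : i ≤ r) :
    ∃ n, n + i = N ∧
      DepthGE n ((Ideal.span (y '' {j | (j : ℕ) < i})).map (algebraMap _ (OriginRing K N))) := by
  induction i with
  | zero => exact ⟨N, by simp, by simpa using depthGE_originRing K N⟩
  | succ i ih =>
    obtain ⟨n, hn, hdep⟩ := ih (by omega)
    have hmem : y ⟨i, hi⟩ ∈ RingHom.ker (constantCoeff (R := K) (σ := Fin N)) := h0 _
    have hreg := JacInd.regMod_map hJ (i := ⟨i, hi⟩) hdep hn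
    have hset : {j : Fin r | (j : ℕ) < i + 1} =
        insert ⟨i, hi⟩ {j : Fin r | (j : ℕ) < i} := by
      ext j
      simp only [Set.mem_ofPred_eq, Set.mem_insert_iff, Fin.ext_iff]
      omega
    rcases n with _ | n
    · exfalso
      have hle := (height_ker_constantCoeff_le K N).trans
        (show ((N : ℕ) : ℕ∞) ≤ r by exact_mod_cast (by omega))
      have := (hJ _ inferInstance hle).card_le_height fun j => h0 j
      have := this.trans (height_ker_constantCoeff_le K N)
      rw [Fintype.card_fin] at this
      have : r ≤ N := by exact_mod_cast this
      omega
    · refine ⟨n, by omega, ?_⟩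
      have := hdep.sup_span (algebraMap_mem_maximalIdeal hmem) hreg
      rw [hset, Set.image_insert_eq, Ideal.span_insert, sup_comm, Ideal.map_sup,
        Ideal.map_span _ {y ⟨i, hi⟩}, Set.image_singleton]
      exact this

end

theorem dvd_or_dvd_of_maximalIdeal_eq_span {C : Type*} [CommRing C] [IsNoetherianRing C]
    [IsLocalRing C] {g : C} (hg : IsLocalRing.maximalIdeal C = Ideal.span {g}) (a b : C) :
    a ∣ b ∨ b ∣ a := by
  have key : ∀ a : C, a ≠ 0 → ∃ k : ℕ, Associated a (g ^ k) := by
    intro a ha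
    have h1 : ∃ k : ℕ, a ∉ IsLocalRing.maximalIdeal C ^ k := by
      by_contra! hcon
      refine ha ?_
      have := Ideal.iInf_pow_eq_bot_of_isLocalRing _ (IsLocalRing.maximalIdeal.isMaximal C).ne_top
      rw [← Ideal.mem_bot, ← this]
      exact (Submodule.mem_iInf _).2 hcon
    classical
    obtain ⟨k, hk⟩ : ∃ k, Nat.find h1 = k + 1 := Nat.exists_eq_succ_of_ne_zero fun h0 => by
      have := Nat.find_spec h1
      rw [h0] at this
      simp at this
    have h2 : a ∈ IsLocalRing.maximalIdeal C ^ k := not_not.1 (Nat.find_min h1 (by omega))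
    have h3 := Nat.find_spec h1
    rw [hk] at h3
    rw [hg, Ideal.span_singleton_pow, Ideal.mem_span_singleton] at h2 h3
    obtain ⟨c, rfl⟩ := h2
    have hc : IsUnit c := by
      by_contra hc
      have : c ∈ IsLocalRing.maximalIdeal C := hc
      rw [hg, Ideal.mem_span_singleton] at this
      exact h3 (pow_succ g k ▸ mul_dvd_mul_left _ this)
    exact ⟨k, (associated_mul_unit_left _ _ hc)⟩
  by_cases ha : a = 0
  · exact Or.inr (ha ▸ dvd_zero b)
  by_cases hb : b = 0
  · exact Or.inl (hb ▸ dvd_zero a)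
  obtain ⟨k, hk⟩ := key a ha
  obtain ⟨l, hl⟩ := key b hb
  rcases le_total k l with h | h
  · exact Or.inl ((hk.dvd_iff_dvd_left).2 ((hl.dvd_iff_dvd_right).2 (pow_dvd_pow g h)))
  · exact Or.inr ((hl.dvd_iff_dvd_left).2 ((hk.dvd_iff_dvd_right).2 (pow_dvd_pow g h)))

theorem dvd_of_pow_mul_eq_pow {C : Type*} [CommRing C] {a b f : C} (n : ℕ)
    (htot : a ∣ b ∨ b ∣ a) (hb : ∀ x, b * x = 0 → x = 0) (h : b ^ n * f = a ^ n) (hn : n ≠ 0) :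
    b ∣ a := by
  refine htot.elim ?_ id
  rintro ⟨c, rfl⟩
  have ha : ∀ x, a * x = 0 → x = 0 := fun x hx => hb x (by rw [mul_right_comm, hx, zero_mul])
  have han : ∀ k x, a ^ k * x = 0 → x = 0 := by
    intro k
    induction k with
    | zero => simp
    | succ k ih => intro x hx; exact ih _ (ha _ (by rwa [← mul_assoc, ← pow_succ']))
  have h1 : c ^ n * f - 1 = 0 := han n _ (by rw [mul_sub, ← mul_assoc, ← mul_pow, h]; ring)
  have hc : IsUnit c := (isUnit_pow_iff hn).1 (IsUnit.of_mul_eq_one f (sub_eq_zero.1 h1))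
  exact (hc.mul_right_dvd).2 dvd_rfl

section
variable {K : Type*} [Field K] {σ : Type*}

theorem homogeneousComponent_mem_span {ι : Type*} {y : ι → MvPolynomial σ K} {e : ι → ℕ}
    (hy : ∀ j, (y j).IsHomogeneous (e j)) {F : MvPolynomial σ K}
    (hF : F ∈ Ideal.span (Set.range y)) (n : ℕ) :
    homogeneousComponent n F ∈ Ideal.span (Set.range y) := by
  let := MvPolynomial.gradedAlgebra (σ := σ) (R := K)
  have h : (Ideal.span (Set.range y)).IsHomogeneous (homogeneousSubmodule σ K) := by
    refine Ideal.homogeneous_span _ _ ?_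
    rintro _ ⟨j, rfl⟩
    exact ⟨e j, hy j⟩
  have := h n hF
  rwa [← MvPolynomial.decomposition.decompose'_apply]

variable (p : ℕ) [Fact p.Prime] [CharP K p]

theorem homogeneousComponent_pow_mul (a F : MvPolynomial σ K) {e i : ℕ}
    (hF : F.IsHomogeneous (p * e)) :
    homogeneousComponent (p * (i + e)) (a ^ p * F) = homogeneousComponent i a ^ p * F := by
  have hp := (Fact.out : p.Prime).pos
  conv_lhs => rw [← sum_homogeneousComponent a, sum_pow_char, Finset.sum_mul, map_sum]
  rw [Finset.sum_eq_single i]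
  · rw [homogeneousComponent_of_mem (n := p * (i + e)), if_pos rfl]
    rw [mul_add, mul_comm p i]
    exact ((homogeneousComponent_isHomogeneous i a).pow p).mul hF
  · intro j _ hj
    rw [homogeneousComponent_of_mem (n := p * (j + e)), if_neg]
    · intro h
      have := Nat.eq_of_mul_eq_mul_left hp h
      omega
    · rw [mul_add, mul_comm p j]
      exact ((homogeneousComponent_isHomogeneous j a).pow p).mul hF
  · intro hi
    rw [homogeneousComponent_eq_zero i a (by simpa using hi), zero_pow hp.ne', zero_mul, map_zero]

theorem exists_isHomogeneous_sub_pow_mem {ι : Type*} {y : ι → MvPolynomial σ K} {d : ι → ℕ}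
    (hy : ∀ j, (y j).IsHomogeneous (d j)) {F s a : MvPolynomial σ K} {e : ℕ}
    (hF : F.IsHomogeneous (p * e)) (hs : constantCoeff s ≠ 0)
    (h : s ^ p * F - a ^ p ∈ Ideal.span (Set.range y)) :
    ∃ b : MvPolynomial σ K, b.IsHomogeneous e ∧ F - b ^ p ∈ Ideal.span (Set.range y) := by
  have h1 := homogeneousComponent_mem_span hy h (p * e)
  have h2 := homogeneousComponent_pow_mul p s F (i := 0) hF
  have h3 := homogeneousComponent_pow_mul p a 1 (i := e) (e := 0) (by simpa using isHomogeneous_one σ K)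
  rw [zero_add] at h2
  rw [mul_one, mul_one, add_zero] at h3
  rw [map_sub, h2, h3, homogeneousComponent_zero, ← constantCoeff_eq] at h1
  refine ⟨C (constantCoeff s)⁻¹ * homogeneousComponent e a, ?_, ?_⟩
  · simpa using (isHomogeneous_C σ _).mul (homogeneousComponent_isHomogeneous e a)
  · convert Ideal.mul_mem_left _ (C (constantCoeff s)⁻¹ ^ p) h1 using 1
    rw [mul_sub, ← mul_assoc, ← mul_pow, ← mul_pow, ← C_mul, inv_mul_cancel₀ hs]
    simp

end

theorem RegMod.mem_sup_of_pow_mul_sub_pow_mem {A : Type*} [CommRing A] [IsNoetherianRing A]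
    [IsLocalRing A] {I : Ideal A} (hI : I ≠ ⊤) {g : A}
    (hg : IsLocalRing.maximalIdeal A = I ⊔ Ideal.span {g}) {a b f : A} {n : ℕ} (hn : n ≠ 0)
    (hb : RegMod I b) (h : b ^ n * f - a ^ n ∈ I) : a ∈ I ⊔ Ideal.span {b} := by
  have := Ideal.Quotient.nontrivial_iff.2 hI
  have := IsLocalRing.of_surjective' (Ideal.Quotient.mk I) Ideal.Quotient.mk_surjective
  have hmax : IsLocalRing.maximalIdeal (A ⧸ I) = Ideal.span {Ideal.Quotient.mk I g} := by
    rw [← IsLocalRing.map_maximalIdeal_of_surjective _ Ideal.Quotient.mk_surjective, hg,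
      Ideal.map_sup, Ideal.map_quotient_self, bot_sup_eq, Ideal.map_span, Set.image_singleton]
  obtain ⟨c, hc⟩ := dvd_of_pow_mul_eq_pow (a := Ideal.Quotient.mk I a)
    (b := Ideal.Quotient.mk I b) (f := Ideal.Quotient.mk I f) n
    (dvd_or_dvd_of_maximalIdeal_eq_span hmax _ _)
    (fun x hx => by
      obtain ⟨x, rfl⟩ := Ideal.Quotient.mk_surjective x
      rw [← map_mul, Ideal.Quotient.eq_zero_iff_mem] at hx
      exact Ideal.Quotient.eq_zero_iff_mem.2 (hb x hx))
    (by rw [← sub_eq_zero]; exact_mod_cast Ideal.Quotient.eq_zero_iff_mem.2 h) hn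
  obtain ⟨c, rfl⟩ := Ideal.Quotient.mk_surjective c
  rw [← map_mul, Ideal.Quotient.eq] at hc
  exact mem_sup_span_singleton'.2 ⟨c, hc⟩

theorem RegMod.pow {A : Type*} [CommRing A] {I : Ideal A} {x : A} (h : RegMod I x) (n : ℕ) :
    RegMod I (x ^ n) := by
  induction n with
  | zero => intro a; simp
  | succ n ih => intro a ha; exact ih a (h _ (by rwa [← mul_assoc, ← pow_succ']))

theorem AssMod.le {A : Type*} [CommRing A] {I P : Ideal A} (h : AssMod I P) : I ≤ P := by
  obtain ⟨-, c, hc⟩ := h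
  exact fun r hr => (hc r).2 (I.mul_mem_right _ hr)

/-- The denominators `b` of `p`-th roots `a / b` of `F` modulo `I`. -/
def pthRootDenominators {A : Type*} [CommRing A] (p : ℕ) [Fact p.Prime] [CharP A p] (I : Ideal A)
    (F : A) : Ideal A where
  carrier := {b | ∃ a, b ^ p * F - a ^ p ∈ I}
  zero_mem' := ⟨0, by simp [(Fact.out : p.Prime).ne_zero]⟩
  add_mem' := by
    rintro b b' ⟨a, ha⟩ ⟨a', ha'⟩
    refine ⟨a + a', ?_⟩
    rw [add_pow_char, add_pow_char]
    convert I.add_mem ha ha' using 1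
    ring
  smul_mem' := by
    rintro c b ⟨a, ha⟩
    refine ⟨c * a, ?_⟩
    convert I.mul_mem_left (c ^ p) ha using 1
    rw [smul_eq_mul]
    ring

theorem mem_pthRootDenominators_of_mul_mem {A : Type*} [CommRing A] (p : ℕ) [Fact p.Prime]
    [CharP A p] {I : Ideal A} {F a b t : A} (h : t * (b ^ p * F - a ^ p) ∈ I) :
    t * b ∈ pthRootDenominators p I F := by
  refine ⟨t * a, ?_⟩
  convert I.mul_mem_left (t ^ (p - 1)) h using 1
  rw [← mul_assoc, ← pow_succ, Nat.sub_add_cancel (Fact.out : p.Prime).one_le]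
  ring

section

variable {K : Type*} [Field K] {N r : ℕ} {y : Fin r → MvPolynomial (Fin N) K}

theorem JacInd.maximalIdeal_eq_sup {P : Ideal (MvPolynomial (Fin N) K)} [P.IsPrime]
    (h : JacInd P y) (hP : Ideal.span (Set.range y) ≤ P) (ht : P.height ≤ r + 1) :
    ∃ g, IsLocalRing.maximalIdeal (Localization.AtPrime P) =
      (Ideal.span (Set.range y)).map (algebraMap _ _) ⊔ Ideal.span {g} := by
  obtain ⟨g, hg⟩ := h.exists_span_eq_maximalIdeal
    (fun j => hP (Ideal.subset_span ⟨j, rfl⟩)) (n := 1) (by simpa using ht)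
  refine ⟨g 0, ?_⟩
  rw [← hg, Ideal.span_union, Ideal.map_span, ← Set.range_comp, Set.range_unique (ι := Fin 1)]
  rfl

theorem JacInd.maximalIdeal_eq {P : Ideal (MvPolynomial (Fin N) K)} [P.IsPrime]
    (h : JacInd P y) (hP : Ideal.span (Set.range y) ≤ P) (ht : P.height ≤ r) :
    IsLocalRing.maximalIdeal (Localization.AtPrime P) =
      (Ideal.span (Set.range y)).map (algebraMap _ _) := by
  obtain ⟨g, hg⟩ := h.exists_span_eq_maximalIdeal
    (fun j => hP (Ideal.subset_span ⟨j, rfl⟩)) (n := 0) (by simpa using ht)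
  rw [← hg, Set.range_eq_empty g, Set.union_empty, Ideal.map_span, ← Set.range_comp]
  rfl

variable (p : ℕ) [Fact p.Prime] [CharP K p] [PerfectRing K p]

variable (K N) in
/-- The polynomials with nonzero constant term. -/
noncomputable abbrev originCompl : Submonoid (MvPolynomial (Fin N) K) :=
  (RingHom.ker (constantCoeff (R := K) (σ := Fin N))).primeCompl

theorem exists_pthRootDenominator (h0 : ∀ j, constantCoeff (y j) = 0)
    (hJ : ∀ P : Ideal (MvPolynomial (Fin N) K), P.IsPrime → P.height ≤ r + 1 → JacInd P y)
    {F : MvPolynomial (Fin N) K} (hF : ∀ v, pderiv v F ∈ Ideal.span (Set.range y)) :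
    ∃ b ∈ pthRootDenominators p (Ideal.span (Set.range y)) F,
      RegMod ((Ideal.span (Set.range y)).map (algebraMap _ (OriginRing K N)))
        (algebraMap _ _ b) := by
  set I := Ideal.span (Set.range y) with hIdef
  set I' := I.map (algebraMap _ (OriginRing K N)) with hI'def
  obtain ⟨n, hn, hdep⟩ := JacInd.depthGE_map h0
    (fun P hP hr => hJ P hP (hr.trans (by simp))) r le_rfl
  have himg : y '' {j | (j : ℕ) < r} = Set.range y := by
    rw [← Set.image_univ]; congr 1; ext j; simp
  rw [himg] at hdep
  have key : ∀ P, AssMod I' P →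
      ¬ (pthRootDenominators p I F).map (algebraMap _ (OriginRing K N)) ≤ P := by
    intro P hP hle
    have hPp := hP.1
    set Pc := P.comap (algebraMap (MvPolynomial (Fin N) K) _) with hPc
    have hIP : I ≤ Pc := Ideal.map_le_iff_le_comap.1 hP.le
    have hht : Pc.height ≤ r := hP.height_comap_le hdep hn
    have hJP := hJ Pc inferInstance (hht.trans (by simp))
    obtain ⟨a, b, hb, hab⟩ := exists_pow_mul_sub_pow_mem p Pc fun v => hIP (hF v)
    have hmem := algebraMap_mem_maximalIdeal hab
    rw [hJP.maximalIdeal_eq hIP hht,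
      IsLocalization.algebraMap_mem_map_algebraMap_iff Pc.primeCompl] at hmem
    obtain ⟨t, ht, htm⟩ := hmem
    have : t * b ∈ Pc := hle (Ideal.mem_map_of_mem _ (mem_pthRootDenominators_of_mul_mem p htm))
    exact ((inferInstance : Pc.IsPrime).mem_or_mem this).elim ht hb
  obtain ⟨x, hxD, hx, -⟩ := exists_regMod_of_forall_not_le key key
  rw [IsLocalization.mem_map_algebraMap_iff (originCompl K N)] at hxD
  obtain ⟨⟨⟨b, hb⟩, m⟩, hm⟩ := hxD
  refine ⟨b, hb, fun c hc => ?_⟩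
  have hu := IsLocalization.map_units (OriginRing K N) m
  simp only at hm
  rw [← hm, mul_assoc] at hc
  exact (Ideal.unit_mul_mem_iff_mem _ hu).1 (hx _ hc)

theorem mem_sup_span_of_pow_mul_sub_pow_mem (h0 : ∀ j, constantCoeff (y j) = 0)
    (hJ : ∀ P : Ideal (MvPolynomial (Fin N) K), P.IsPrime → P.height ≤ r + 1 → JacInd P y)
    {F a b : MvPolynomial (Fin N) K} {q : ℕ} (hq : q ≠ 0)
    (hb : RegMod ((Ideal.span (Set.range y)).map (algebraMap _ (OriginRing K N)))
        (algebraMap _ _ b)) (hab : b ^ q * F - a ^ q ∈ Ideal.span (Set.range y)) :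
    algebraMap _ (OriginRing K N) a ∈
      (Ideal.span (Set.range y) ⊔ Ideal.span {b}).map (algebraMap _ (OriginRing K N)) := by
  set I := Ideal.span (Set.range y) with hIdef
  obtain ⟨n, hn, hdep⟩ := JacInd.depthGE_map h0
    (fun P hP hr => hJ P hP (hr.trans (by simp))) r le_rfl
  have himg : y '' {j | (j : ℕ) < r} = Set.range y := by
    rw [← Set.image_univ]; congr 1; ext j; simp
  rw [himg] at hdep
  by_contra hcon
  obtain ⟨P, hP, hP'⟩ := exists_assMod hcon
  have hPp := hP.1
  set Pc := P.comap (algebraMap (MvPolynomial (Fin N) K) _) with hPc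
  have hle : I ⊔ Ideal.span {b} ≤ Pc := Ideal.map_le_iff_le_comap.1 hP.le
  have hIP : I ≤ Pc := le_sup_left.trans hle
  have hbP : algebraMap _ (OriginRing K N) b ∈ P :=
    hle (Ideal.mem_sup_right (Ideal.mem_span_singleton_self b))
  rw [Ideal.map_sup, Ideal.map_span _ {b}, Set.image_singleton] at hP
  have hht : Pc.height ≤ r + 1 := by
    cases n with
    | zero => exact (hP.height_comap_le (n := 0) trivial (i := r) (by omega)).trans (by simp)
    | succ n =>
      exact_mod_cast hP.height_comap_le
        (hdep.sup_span (IsLocalRing.le_maximalIdeal hPp.ne_top hbP) hb) (i := r + 1) (by omega)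
  have hJP := hJ Pc inferInstance hht
  obtain ⟨g, hg⟩ := hJP.maximalIdeal_eq_sup hIP hht
  have hmem : algebraMap _ (Localization.AtPrime Pc) a ∈
      I.map (algebraMap _ (Localization.AtPrime Pc)) ⊔ Ideal.span {algebraMap _ _ b} := by
    refine RegMod.mem_sup_of_pow_mul_sub_pow_mem (f := algebraMap _ _ F) ?_ hg hq ?_ ?_
    · refine ne_top_of_le_ne_top (IsLocalRing.maximalIdeal.isMaximal _).ne_top ?_
      exact hg ▸ le_sup_left
    · intro x hx
      obtain ⟨x, s, rfl⟩ := IsLocalization.exists_mk'_eq Pc.primeCompl x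
      rw [← IsLocalization.mk'_one (M := Pc.primeCompl) (Localization.AtPrime Pc) b,
        ← IsLocalization.mk'_mul, IsLocalization.mk'_mem_map_algebraMap_iff] at hx
      obtain ⟨t, ht, htm⟩ := hx
      have h1 := Ideal.mem_map_of_mem (algebraMap _ (OriginRing K N)) htm
      rw [mul_left_comm, map_mul] at h1
      have h2 := hb _ h1
      rw [IsLocalization.algebraMap_mem_map_algebraMap_iff (originCompl K N)] at h2
      obtain ⟨u, hu, hum⟩ := h2
      rw [IsLocalization.mk'_mem_map_algebraMap_iff]
      refine ⟨u * t, mul_mem (fun hu' => hu ?_) ht, by rwa [mul_assoc]⟩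
      have := IsLocalRing.le_maximalIdeal hPp.ne_top hu'
      rwa [← IsLocalization.AtPrime.under_maximalIdeal (OriginRing K N)
        (RingHom.ker (constantCoeff (R := K) (σ := Fin N)))]
    · rw [← map_pow, ← map_pow, ← map_mul, ← map_sub]
      exact Ideal.mem_map_of_mem _ hab
  rw [← Set.image_singleton, ← Ideal.map_span _ {b}, ← Ideal.map_sup,
    IsLocalization.algebraMap_mem_map_algebraMap_iff Pc.primeCompl] at hmem
  obtain ⟨t, ht, htm⟩ := hmem
  refine ht (hP' _ ?_)
  rw [← map_mul]
  exact Ideal.mem_map_of_mem _ htm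

theorem exists_sub_pow_mem_span {d : Fin r → ℕ} (hy : ∀ j, (y j).IsHomogeneous (d j))
    (h0 : ∀ j, constantCoeff (y j) = 0)
    (hJ : ∀ P : Ideal (MvPolynomial (Fin N) K), P.IsPrime → P.height ≤ r + 1 → JacInd P y)
    {F : MvPolynomial (Fin N) K} {e : ℕ} (hF : F.IsHomogeneous (p * e))
    (hdF : ∀ v, pderiv v F ∈ Ideal.span (Set.range y)) :
    ∃ h : MvPolynomial (Fin N) K, h.IsHomogeneous e ∧ F - h ^ p ∈ Ideal.span (Set.range y) := by
  have hp := (Fact.out : p.Prime).ne_zero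
  obtain ⟨b, ⟨a, hab⟩, hb⟩ := exists_pthRootDenominator p h0 hJ hdF
  have hmem := mem_sup_span_of_pow_mul_sub_pow_mem h0 hJ hp hb hab
  rw [IsLocalization.algebraMap_mem_map_algebraMap_iff (originCompl K N)] at hmem
  obtain ⟨s, hs, hsm⟩ := hmem
  obtain ⟨c, hc⟩ := mem_sup_span_singleton'.1 hsm
  have h1 : b ^ p * (s ^ p * F - c ^ p) ∈ Ideal.span (Set.range y) := by
    convert Ideal.add_mem _ (Ideal.mul_mem_left _ (s ^ p) hab)
      (Ideal.mem_of_dvd _ (sub_dvd_pow_sub_pow _ _ p) hc) using 1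
    ring
  have h2 := Ideal.mem_map_of_mem (algebraMap _ (OriginRing K N)) h1
  rw [map_mul, map_pow] at h2
  have h3 := hb.pow p _ h2
  rw [IsLocalization.algebraMap_mem_map_algebraMap_iff (originCompl K N)] at h3
  obtain ⟨t, ht, htm⟩ := h3
  refine exists_isHomogeneous_sub_pow_mem p hy hF (s := t * s) (a := t * c)
    (mul_mem (S := Submonoid _) ht hs) ?_
  convert Ideal.mul_mem_left _ (t ^ (p - 1)) htm using 1
  rw [← mul_assoc, ← pow_succ, Nat.sub_add_cancel (Fact.out : p.Prime).one_le]
  ring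

end

theorem Ideal.IsPrime.exists_common_denominator {R ι : Type*} [CommRing R] [Finite ι] (P : Ideal R)
    [P.IsPrime] (x : ι → FractionRing (R ⧸ P)) :
    ∃ s, s ∉ P ∧ ∃ y : ι → R, ∀ i,
      ((algebraMap (R ⧸ P) (FractionRing (R ⧸ P))).comp (Ideal.Quotient.mk P)) (y i) =
        ((algebraMap (R ⧸ P) (FractionRing (R ⧸ P))).comp (Ideal.Quotient.mk P)) s * x i := by
  obtain ⟨s, hs⟩ := IsLocalization.exist_integer_multiples_of_finite
    (nonZeroDivisors (R ⧸ P)) x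
  choose y hy using hs
  obtain ⟨s', hs'⟩ := Ideal.Quotient.mk_surjective (s : R ⧸ P)
  choose y' hy' using fun i => Ideal.Quotient.mk_surjective (y i)
  refine ⟨s', fun hmem => ?_, y', fun i => ?_⟩
  · exact nonZeroDivisors.coe_ne_zero s (hs' ▸ Ideal.Quotient.eq_zero_iff_mem.2 hmem)
  · simp only [RingHom.comp_apply, hs', hy', hy, Algebra.smul_def]

theorem Ideal.IsPrime.exists_rightInverse {R J V : Type*} [CommRing R] [Fintype J] [Fintype V]
    [DecidableEq J] (P : Ideal R) [P.IsPrime] {D : J → V → R}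
    (h : ∀ a : J → R, (∀ v, ∑ j, a j * D j v ∈ P) → ∀ j, a j ∈ P) :
    ∃ d ∉ P, ∃ X : V → J → R, ∀ j j', ∑ v, D j v * X v j' - (if j = j' then d else 0) ∈ P := by
  classical
  set L := FractionRing (R ⧸ P)
  set q : R →+* L := (algebraMap (R ⧸ P) L).comp (Ideal.Quotient.mk P) with hqdef
  have hq : ∀ x, q x = 0 ↔ x ∈ P := fun x => by
    rw [hqdef, RingHom.comp_apply, FaithfulSMul.algebraMap_eq_zero_iff,
      Ideal.Quotient.eq_zero_iff_mem]
  let f : (J → L) →ₗ[L] (V → L) := Fintype.linearCombination L fun j v => q (D j v)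
  have hf : LinearMap.ker f = ⊥ := by
    rw [LinearMap.ker_eq_bot']
    intro x hx
    obtain ⟨s, hs, y, hy⟩ := Ideal.IsPrime.exists_common_denominator P x
    have hy : ∀ j, q (y j) = q s * x j := hy
    have hy' : ∀ j, y j ∈ P := h y fun v => by
      rw [← hq, map_sum]
      have := congrFun hx v
      simp only [f, Fintype.linearCombination_apply, Finset.sum_apply, Pi.smul_apply,
        smul_eq_mul, Pi.zero_apply] at this
      simp_rw [map_mul, hy, mul_assoc, ← Finset.mul_sum, this, mul_zero]
    ext j
    have := hy j
    rw [(hq _).2 (hy' j)] at this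
    exact (mul_eq_zero.1 this.symm).resolve_left (mt (hq s).1 hs)
  obtain ⟨g, hg⟩ := f.exists_leftInverse_of_injective hf
  obtain ⟨s, hs, X, hX⟩ := Ideal.IsPrime.exists_common_denominator P
    fun i : V × J => g (Pi.single i.1 1) i.2
  have hX : ∀ i : V × J, q (X i) = q s * g (Pi.single i.1 1) i.2 := hX
  refine ⟨s, hs, fun v j => X (v, j), fun j j' => ?_⟩
  rw [← hq, map_sub, map_sum, sub_eq_zero]
  have h1 := congrFun (LinearMap.congr_fun hg (Pi.single j 1)) j'
  simp only [LinearMap.comp_apply, LinearMap.id_apply, f,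
    Fintype.linearCombination_apply_single, one_smul] at h1
  have h2 : (fun v => q (D j v)) = ∑ v, q (D j v) • (Pi.single v 1 : V → L) := by
    ext w
    simp [Finset.sum_apply, Pi.single_apply]
  rw [h2, map_sum, Finset.sum_apply] at h1
  simp only [map_smul, Pi.smul_apply, smul_eq_mul] at h1
  simp_rw [map_mul, hX, mul_left_comm _ (q s), ← Finset.mul_sum]
  rw [h1, Pi.single_apply]
  by_cases hj : j = j' <;> simp [hj, eq_comm]

/-- First order Taylor expansion of algebra homomorphisms. -/
theorem MvPolynomial.aeval_add_of_mul_eq_zero {K σ B : Type*} [CommRing K] [Fintype σ] [CommRing B]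
    [Algebra K B] (φ ψ : MvPolynomial σ K →ₐ[K] B)
    (h : ∀ v w, (φ (X v) - ψ (X v)) * (φ (X w) - ψ (X w)) = 0) (F : MvPolynomial σ K) :
    φ F = ψ F + ∑ v, ψ (pderiv v F) * (φ (X v) - ψ (X v)) := by
  classical
  induction F using MvPolynomial.induction_on with
  | C a =>
    simp only [pderiv_C, map_zero, zero_mul, Finset.sum_const_zero, add_zero]
    rw [← algebraMap_eq, AlgHom.commutes, AlgHom.commutes]
  | add F G hF hG =>
    simp only [map_add, add_mul, Finset.sum_add_distrib]
    rw [hF, hG]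
    ring
  | mul_X F w hF =>
    simp only [Derivation.leibniz, pderiv_X, smul_eq_mul, map_add, map_mul, add_mul,
      Finset.sum_add_distrib]
    have h1 : ∑ v, ψ F * ψ (Pi.single (M := fun _ => MvPolynomial σ K) v 1 w) * (φ (X v) - ψ (X v)) =
        ψ F * (φ (X w) - ψ (X w)) := by
      rw [Finset.sum_eq_single w]
      · simp
      · intro v _ hv
        simp [hv.symm]
      · simp
    have h2 : (∑ v, ψ (pderiv v F) * (φ (X v) - ψ (X v))) * (φ (X w) - ψ (X w)) = 0 := by
      rw [Finset.sum_mul]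
      exact Finset.sum_eq_zero fun v _ => by rw [mul_assoc, h, mul_zero]
    have h3 : ∑ v, ψ (X w) * ψ (pderiv v F) * (φ (X v) - ψ (X v)) =
        ψ (X w) * ∑ v, ψ (pderiv v F) * (φ (X v) - ψ (X v)) := by
      simp [Finset.mul_sum, mul_assoc]
    rw [h1, h3, hF]
    linear_combination h2

theorem IsLocalRing.exists_algHom_quotient_sq {K A : Type*} [Field K] [PerfectField K]
    [CommRing A] [IsLocalRing A] [Algebra K A]
    [Algebra.EssFiniteType K (IsLocalRing.ResidueField A)] :
    ∃ l : IsLocalRing.ResidueField A →ₐ[K] A ⧸ (IsLocalRing.maximalIdeal A) ^ 2,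
      ∀ a, Ideal.Quotient.mk _ a - l (IsLocalRing.residue A a) ∈
        (IsLocalRing.maximalIdeal A).map (Ideal.Quotient.mk (IsLocalRing.maximalIdeal A ^ 2)) := by
  set m := IsLocalRing.maximalIdeal A
  have : Algebra.FormallySmooth K (IsLocalRing.ResidueField A) := inferInstance
  have hle : m ^ 2 ≤ m := Ideal.pow_le_self two_ne_zero
  let g : A ⧸ m ^ 2 →ₐ[K] IsLocalRing.ResidueField A :=
    Ideal.Quotient.liftₐ (m ^ 2) (IsScalarTower.toAlgHom K A _) fun a ha => by
      exact (IsLocalRing.residue_eq_zero_iff a).2 (hle ha)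
  have hgmk : ∀ a, g (Ideal.Quotient.mk _ a) = IsLocalRing.residue A a := fun a => rfl
  have hg : Function.Surjective g := fun y => by
    obtain ⟨a, rfl⟩ := IsLocalRing.residue_surjective y
    exact ⟨Ideal.Quotient.mk _ a, hgmk a⟩
  have hmem : ∀ y, g y = 0 → y ∈ m.map (Ideal.Quotient.mk (m ^ 2)) := fun y hy => by
    obtain ⟨a, rfl⟩ := Ideal.Quotient.mk_surjective y
    rw [hgmk] at hy
    exact Ideal.mem_map_of_mem _ ((IsLocalRing.residue_eq_zero_iff a).1 hy)
  have hker : IsNilpotent (RingHom.ker (g : A ⧸ m ^ 2 →+* IsLocalRing.ResidueField A)) := by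
    refine ⟨2, le_bot_iff.1 ((Ideal.pow_right_mono (fun y hy => hmem y hy) 2).trans ?_)⟩
    rw [← Ideal.map_pow, Ideal.map_quotient_self]
  refine ⟨Algebra.FormallySmooth.liftOfSurjective (AlgHom.id K _) g hg hker, fun a => hmem _ ?_⟩
  rw [map_sub, hgmk, sub_eq_zero]
  exact (Algebra.FormallySmooth.liftOfSurjective_apply (AlgHom.id K _) g hg hker _).symm

theorem MvPolynomial.map_sum_mul_eq_zero {K σ B J : Type*} [CommRing K] [Fintype σ] [Fintype J]
    [CommRing B] [Algebra K B] {p : Ideal (MvPolynomial σ K)} {n : Ideal B}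
    (hn : ∀ x ∈ n, ∀ y ∈ n, x * y = 0)
    (φ ψ : MvPolynomial σ K →ₐ[K] B) (h : ∀ F, φ F - ψ F ∈ n) (hφ : ∀ F ∈ p, φ F ∈ n)
    (hψ : ∀ F ∈ p, ψ F = 0) {t a : J → MvPolynomial σ K} (ht : ∀ i, t i ∈ p)
    (ha : ∀ v, ∑ j, a j * pderiv v (t j) ∈ p) : φ (∑ i, a i * t i) = 0 := by
  have htay := MvPolynomial.aeval_add_of_mul_eq_zero φ ψ fun v w => hn _ (h _) _ (h _)
  have h1 : φ (∑ i, a i * t i) = ∑ i, ψ (a i) * φ (t i) := by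
    rw [map_sum]
    refine Finset.sum_congr rfl fun i _ => ?_
    rw [map_mul, ← sub_eq_zero, ← sub_mul]
    exact hn _ (h _) _ (hφ _ (ht i))
  have h2 : ∀ i, φ (t i) = ∑ v, ψ (pderiv v (t i)) * (φ (X v) - ψ (X v)) := fun i => by
    rw [htay (t i), hψ _ (ht i), zero_add]
  rw [h1]
  simp_rw [h2, Finset.mul_sum, ← mul_assoc, ← map_mul]
  rw [Finset.sum_comm]
  refine Finset.sum_eq_zero fun v _ => ?_
  rw [← Finset.sum_mul, ← map_sum, hψ _ (ha v), zero_mul]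

section

variable {K M : Type*} [Field K] [PerfectField K] [Fintype M]

theorem mul_sum_mem_maximalIdeal_sq {J : Type*} [Fintype J] (p : Ideal (MvPolynomial M K))
    [p.IsPrime] {t a : J → MvPolynomial M K} (ht : ∀ i, t i ∈ p)
    (ha : ∀ v, ∑ j, a j * pderiv v (t j) ∈ p) :
    algebraMap _ (Localization.AtPrime p) (∑ i, a i * t i) ∈
      IsLocalRing.maximalIdeal (Localization.AtPrime p) ^ 2 := by
  have : Algebra.EssFiniteType K (IsLocalRing.ResidueField (Localization.AtPrime p)) := by
    have h : Algebra.EssFiniteType K (Localization.AtPrime p) := inferInstance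
    exact Algebra.EssFiniteType.of_surjective (IsScalarTower.toAlgHom K (Localization.AtPrime p) _)
      IsLocalRing.residue_surjective
  obtain ⟨l, hl⟩ := IsLocalRing.exists_algHom_quotient_sq (K := K) (A := Localization.AtPrime p)
  rw [← Ideal.Quotient.eq_zero_iff_mem]
  refine MvPolynomial.map_sum_mul_eq_zero
    (n := (IsLocalRing.maximalIdeal _).map (Ideal.Quotient.mk _)) (fun x hx y hy => ?_)
    ((Ideal.Quotient.mkₐ K _).comp
      (IsScalarTower.toAlgHom K (MvPolynomial M K) (Localization.AtPrime p)))
    (l.comp ((IsScalarTower.toAlgHom K (Localization.AtPrime p) _).comp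
      (IsScalarTower.toAlgHom K (MvPolynomial M K) (Localization.AtPrime p))))
    (fun F => hl _) (fun F hF => Ideal.mem_map_of_mem _ (algebraMap_mem_maximalIdeal hF))
    (fun F hF => ?_) ht ha
  · have h0 := Ideal.map_quotient_self (IsLocalRing.maximalIdeal (Localization.AtPrime p) ^ 2)
    have hxy := Ideal.mul_mem_mul hx hy
    rwa [← Ideal.map_mul, ← pow_two, h0, Ideal.mem_bot] at hxy
  · have : IsLocalRing.residue (Localization.AtPrime p) (algebraMap _ _ F) = 0 :=
      (IsLocalRing.residue_eq_zero_iff _).2 (algebraMap_mem_maximalIdeal hF)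
    change l (IsLocalRing.residue (Localization.AtPrime p) (algebraMap _ _ F)) = 0
    rw [this, map_zero]

theorem exists_jacInd_of_isPrime (p : Ideal (MvPolynomial M K)) [p.IsPrime] :
    ∃ (n : ℕ) (t : Fin n → MvPolynomial M K), (∀ i, t i ∈ p) ∧ JacInd p t ∧ p.height = n := by
  set A := Localization.AtPrime p
  set κ := IsLocalRing.ResidueField A
  set m := IsLocalRing.maximalIdeal A
  let b := Module.finBasis κ (IsLocalRing.CotangentSpace A)
  choose x hx using fun i => m.toCotangent_surjective (b i)
  obtain ⟨s, hs⟩ := IsLocalization.exist_integer_multiples_of_finite p.primeCompl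
    fun i => (x i : A)
  choose t ht using hs
  have ht' : ∀ i, algebraMap _ A (t i) = algebraMap _ A (s : MvPolynomial M K) * x i :=
    fun i => by rw [ht, Algebra.smul_def]
  have htp : ∀ i, t i ∈ p := fun i => by
    rw [← IsLocalization.AtPrime.to_map_mem_maximal_iff A p, ht']
    exact Ideal.mul_mem_left _ _ (x i).2
  refine ⟨_, t, htp, fun a ha => ?_, (finrank_cotangentSpace_localization p).symm⟩
  have h1 : ∑ i, (algebraMap _ A (s : MvPolynomial M K) * algebraMap _ A (a i)) • x i ∈
      LinearMap.ker m.toCotangent := by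
    rw [LinearMap.mem_ker, Ideal.toCotangent_eq_zero]
    convert mul_sum_mem_maximalIdeal_sq p htp ha using 1
    simp only [Submodule.coe_sum, Submodule.coe_smul, smul_eq_mul, map_sum, map_mul]
    exact Finset.sum_congr rfl fun i _ => by rw [ht' i]; ring
  rw [LinearMap.mem_ker, map_sum] at h1
  have h2 : ∑ i, (IsLocalRing.residue A
      (algebraMap _ A (s : MvPolynomial M K) * algebraMap _ A (a i))) • b i = 0 := by
    rw [← h1]
    refine Finset.sum_congr rfl fun i _ => ?_
    rw [map_smul, hx]
    rfl
  have h3 := Fintype.linearIndependent_iff.1 b.linearIndependent _ h2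
  intro i
  have h4 := h3 i
  rw [IsLocalRing.residue_eq_zero_iff, ← map_mul,
    IsLocalization.AtPrime.to_map_mem_maximal_iff A p] at h4
  exact ((inferInstance : p.IsPrime).mem_or_mem h4).resolve_left s.2

theorem pderiv_aeval {K M σ : Type*} [Field K] [Fintype M] (G : M → MvPolynomial σ K) (v : σ)
    (t : MvPolynomial M K) :
    pderiv v (aeval G t) = ∑ m, aeval G (pderiv m t) * pderiv v (G m) := by
  classical
  induction t using MvPolynomial.induction_on with
  | C a => simp [algebraMap_eq]
  | add p q hp hq => simp only [map_add, hp, hq, add_mul, Finset.sum_add_distrib]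
  | mul_X p n hp =>
    simp only [map_mul, aeval_X, Derivation.leibniz, smul_eq_mul, map_add, add_mul, pderiv_X,
      Finset.sum_add_distrib, hp, Finset.mul_sum]
    congr 1
    · rw [Finset.sum_eq_single n]
      · simp
      · intro m _ hm
        simp [hm.symm]
      · simp
    · exact Finset.sum_congr rfl fun _ _ => by ring

/-- A prime at which `G` has independent Jacobian rows contracts to a prime of no greater height. -/
theorem JacInd.height_comap_aeval_le {σ : Type*} [Finite σ] {P : Ideal (MvPolynomial σ K)}
    [P.IsPrime] {G : M → MvPolynomial σ K} (h : JacInd P G) :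
    (P.comap (aeval G : MvPolynomial M K →ₐ[K] MvPolynomial σ K)).height ≤ P.height := by
  classical
  set p := P.comap (aeval G : MvPolynomial M K →ₐ[K] MvPolynomial σ K)
  have : p.IsPrime := Ideal.comap_isPrime _ _
  obtain ⟨n, t, ht, hJ, hn⟩ := exists_jacInd_of_isPrime p
  obtain ⟨d, hd, X, hX⟩ := Ideal.IsPrime.exists_rightInverse p (D := fun i m => pderiv m (t i)) hJ
  have key : JacInd P fun i => aeval G (t i) := by
    intro a ha
    have h1 : ∀ m, ∑ i, a i * aeval G (pderiv m (t i)) ∈ P := by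
      refine h _ fun v => ?_
      convert ha v using 1
      simp_rw [pderiv_aeval, Finset.mul_sum, Finset.sum_mul]
      rw [Finset.sum_comm]
      exact Finset.sum_congr rfl fun _ _ => Finset.sum_congr rfl fun _ _ => by ring
    intro i'
    have h2 : ∑ i, a i * aeval G (∑ m, pderiv m (t i) * X m i') ∈ P := by
      have : ∑ m, aeval G (X m i') * ∑ i, a i * aeval G (pderiv m (t i)) ∈ P :=
        P.sum_mem fun m _ => P.mul_mem_left _ (h1 m)
      convert this using 1
      simp_rw [map_sum, Finset.mul_sum, map_mul]
      rw [Finset.sum_comm]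
      exact Finset.sum_congr rfl fun _ _ => Finset.sum_congr rfl fun _ _ => by ring
    have h3 : ∑ i, a i * aeval G (∑ m, pderiv m (t i) * X m i' - if i = i' then d else 0) ∈ P :=
      P.sum_mem fun i _ => P.mul_mem_left _ (hX i i')
    have h4 := P.sub_mem h2 h3
    rw [← Finset.sum_sub_distrib] at h4
    simp_rw [map_sub, ← mul_sub, sub_sub_cancel] at h4
    rw [Finset.sum_eq_single i' (fun i _ hi => by simp [hi]) (by simp)] at h4
    rw [if_pos rfl] at h4
    exact ((inferInstance : P.IsPrime).mem_or_mem h4).resolve_right hd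
  rw [hn]
  simpa using key.card_le_height ht

end

theorem Submodule.exists_fin_iInf_eq {L E V : Type*} [Field L] [AddCommGroup E] [Module L E]
    [FiniteDimensional L E] (A : V → Submodule L E) :
    ∃ (ρ : ℕ) (v : Fin ρ → V), ρ + Module.finrank L ↥(⨅ v, A v) ≤ Module.finrank L E ∧
      ⨅ l, A (v l) = ⨅ v, A v := by
  classical
  let p : ℕ → Prop := fun ρ => ∃ v : Fin ρ → V,
    ρ + Module.finrank L ↥(⨅ l, A (v l)) ≤ Module.finrank L E
  have h0 : p 0 := ⟨Fin.elim0, by simpa using Submodule.finrank_le _⟩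
  obtain ⟨ρ, hρ⟩ : ∃ ρ, ρ = Nat.findGreatest p (Module.finrank L E) := ⟨_, rfl⟩
  obtain ⟨v, hv⟩ : p ρ := hρ ▸ Nat.findGreatest_spec (Nat.zero_le (Module.finrank L E)) h0
  have heq : ⨅ l, A (v l) = ⨅ v, A v := by
    refine le_antisymm (le_iInf fun w => ?_) (le_iInf fun l => iInf_le _ _)
    by_contra hw
    have hlt : A w ⊓ ⨅ l, A (v l) < ⨅ l, A (v l) := inf_le_right.lt_of_ne fun h => hw (by
      rw [← h]; exact inf_le_left)
    have h1 := Submodule.finrank_lt_finrank_of_lt hlt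
    have h2 : p (ρ + 1) := by
      refine ⟨Fin.cons w v, ?_⟩
      have : ⨅ l : Fin (ρ + 1), A ((Fin.cons w v : Fin (ρ + 1) → V) l) = A w ⊓ ⨅ l, A (v l) := by
        refine le_antisymm (le_inf ?_ (le_iInf fun l => ?_)) (le_iInf fun l => ?_)
        · exact iInf_le (fun l : Fin (ρ + 1) => A ((Fin.cons w v : Fin (ρ + 1) → V) l)) 0
        · exact iInf_le (fun l : Fin (ρ + 1) => A ((Fin.cons w v : Fin (ρ + 1) → V) l)) l.succ
        · cases l using Fin.cases with
          | zero => exact inf_le_left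
          | succ l => exact inf_le_right.trans (iInf_le _ l)
      rw [this]
      omega
    have h3 : ρ + 1 ≤ ρ := (Nat.le_findGreatest (by obtain ⟨_, h⟩ := h2; omega) h2).trans hρ.ge
    omega
  exact ⟨ρ, v, heq ▸ hv, heq⟩

section
variable {ι : Type*}

theorem Filter.Eventually.dchoice {Z : ι → Type*} [∀ i, Nonempty (Z i)] {l : Filter ι}
    {q : ∀ i, Z i → Prop} (h : ∀ᶠ i in l, ∃ y, q i y) :
    ∃ y : ∀ i, Z i, ∀ᶠ i in l, q i (y i) := by
  classical
  refine ⟨fun i => if h : ∃ y, q i y then h.choose else Classical.arbitrary _, ?_⟩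
  filter_upwards [h] with i hi
  rw [dif_pos hi]
  exact hi.choose_spec

end

theorem HasCollapse.of_mem_span {K σ M : Type*} [CommSemiring K] [Fintype M] {n : ℕ}
    {F : MvPolynomial σ K} {y : M → MvPolynomial σ K} {g : M → ℕ}
    (hg : ∀ m, 0 < g m ∧ g m < n) (hy : ∀ m, (y m).IsHomogeneous (g m))
    (hF : F ∈ Ideal.span (Set.range y)) : HasCollapse n (Fintype.card M) F := by
  let f := Fintype.equivFin M
  refine ⟨y ∘ f.symm, g ∘ f.symm, fun i => ⟨(hg _).1, (hg _).2, hy _⟩, ?_⟩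
  rwa [f.symm.surjective.range_comp]

theorem exists_homogeneous_coeffs {K σ M : Type*} [CommRing K] [Fintype M] {n : ℕ}
    {F : MvPolynomial σ K} {y : M → MvPolynomial σ K} {g : M → ℕ}
    (hg : ∀ m, g m ≤ n) (hy : ∀ m, (y m).IsHomogeneous (g m)) (hFn : F.IsHomogeneous n)
    (hF : F ∈ Ideal.span (Set.range y)) :
    ∃ Q : M → MvPolynomial σ K, (∀ m, (Q m).IsHomogeneous (n - g m)) ∧ F = ∑ m, Q m * y m := by
  obtain ⟨c, hc⟩ := (Ideal.mem_span_range_iff_exists_fun).1 hF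
  refine ⟨fun m => homogeneousComponent (n - g m) (c m), fun m =>
    homogeneousComponent_isHomogeneous _ _, ?_⟩
  have h1 : homogeneousComponent n F = F := by
    rw [homogeneousComponent_of_mem hFn, if_pos rfl]
  rw [← h1, ← hc, map_sum]
  refine Finset.sum_congr rfl fun m _ => ?_
  conv_lhs => rw [← sum_homogeneousComponent (c m), Finset.sum_mul, map_sum]
  have h2 : ∀ k, homogeneousComponent n (homogeneousComponent k (c m) * y m) =
      if k = n - g m then homogeneousComponent k (c m) * y m else 0 := fun k => by
    rw [homogeneousComponent_of_mem ((homogeneousComponent_isHomogeneous k (c m)).mul (hy m))]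
    have := hg m
    congr 1
    exact propext (by omega)
  simp_rw [h2]
  rw [Finset.sum_ite_eq']
  split_ifs with h
  · rfl
  · rw [Finset.mem_range, not_lt] at h
    rw [homogeneousComponent_eq_zero _ _ (by omega), zero_mul]

theorem map_sumElim_univ_add_singleton {L Q α : Type*} [Fintype L] [Fintype Q] [DecidableEq L]
    (l₀ : L) (b : Q → α) (a : L → α) :
    Finset.univ.val.map (Sum.elim b fun l : {l // l ≠ l₀} => a l) + {a l₀} =
      Finset.univ.val.map a + Finset.univ.val.map b := by
  have h1 : (Finset.univ : Finset L).val.map a =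
      a l₀ ::ₘ (Finset.univ : Finset {l // l ≠ l₀}).val.map (fun l : {l // l ≠ l₀} => a l) := by
    have h : Finset.univ.erase l₀ =
        (Finset.univ : Finset {l // l ≠ l₀}).map (Function.Embedding.subtype _) := by
      ext; simp
    rw [← Finset.insert_erase (Finset.mem_univ l₀), Finset.insert_val_of_notMem
      (Finset.notMem_erase _ _), Multiset.map_cons, h, Finset.map_val, Multiset.map_map]
    rfl
  rw [h1]
  simp [← Finset.univ_disjSum_univ, Finset.disjSum, Multiset.disjSum]
  rw [← Multiset.singleton_add]
  abel

/-- The homogeneous `K i`-linear combinations of the `G i j` become arbitrarily strong along `U`. -/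
def IsStrongFamily {ι : Type*} {K : ι → Type*} [∀ i, Field (K i)] {σ : ι → Type*}
    (U : Ultrafilter ι) {J : Type*} [Fintype J] (e : J → ℕ)
    (G : ∀ i, J → MvPolynomial (σ i) (K i)) : Prop :=
  (∀ᶠ i in U, ∀ j, (G i j).IsHomogeneous (e j)) ∧
    ∀ k, ∀ᶠ i in U, ∀ (n : ℕ) (c : J → K i), c ≠ 0 → (∀ j, c j ≠ 0 → e j = n) →
      ¬HasCollapse n k (∑ j, c j • G i j)

section
variable {ι : Type*} {K : ι → Type*} [∀ i, Field (K i)] {σ : ι → Type*} {U : Ultrafilter ι}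
  {J : Type} [Fintype J] {e : J → ℕ} {G : ∀ i, J → MvPolynomial (σ i) (K i)}

theorem IsStrongFamily.comp_injective (h : IsStrongFamily U e G) {J' : Type} [Fintype J']
    {f : J' → J} (hf : Function.Injective f) :
    IsStrongFamily U (e ∘ f) (fun i => G i ∘ f) := by
  classical
  refine ⟨h.1.mono fun i hi j => hi _, fun k => (h.2 k).mono fun i hi n c hc hn => ?_⟩
  have hext : ∀ j, Function.extend f c 0 (f j) = c j := fun j => hf.extend_apply _ _ _
  have hsupp : ∀ j, Function.extend f c 0 j ≠ 0 → ∃ j', f j' = j := fun j hj => by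
    by_contra hcon
    exact hj (Function.extend_apply' _ _ _ hcon)
  have h1 := hi n (Function.extend f c 0) (fun h0 => hc ?_) ?_
  · have h2 : ∑ j, c j • (G i ∘ f) j = ∑ j, Function.extend f c 0 j • G i j := by
      refine Finset.sum_of_injOn f hf.injOn (fun _ _ => Finset.mem_coe.2 (Finset.mem_univ _))
        (fun j _ hj => ?_) fun j _ => ?_
      · by_cases h0 : Function.extend f c 0 j = 0
        · rw [h0, zero_smul]
        · obtain ⟨j', rfl⟩ := hsupp j h0
          exact (hj ⟨j', by simp⟩).elim
      · rw [hext]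
        rfl
    rwa [h2]
  · funext j
    rw [← hext, h0]
    rfl
  · intro j hj
    obtain ⟨j', rfl⟩ := hsupp j hj
    rw [hext] at hj
    exact hn j' hj

/-- If `(w, G)` is not strong, one of the forms in `w` can be rewritten in terms of the others and
forms of smaller degree. -/
theorem IsStrongFamily.exists_collapse (hG : IsStrongFamily U e G) {L : Type} [Fintype L]
    {a : L → ℕ} {w : ∀ i, L → MvPolynomial (σ i) (K i)}
    (hw : ∀ᶠ i in U, ∀ l, (w i l).IsHomogeneous (a l))
    (hS : ¬IsStrongFamily U (Sum.elim a e) (fun i => Sum.elim (w i) (G i))) :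
    ∃ (l₀ : L) (Q : Type) (_ : Fintype Q) (b : Q → ℕ) (z : ∀ i, Q → MvPolynomial (σ i) (K i)),
      (∀ q, b q < a l₀) ∧ (∀ᶠ i in U, ∀ q, (z i q).IsHomogeneous (b q)) ∧
      ∀ᶠ i in U, w i l₀ ∈ Algebra.adjoin (K i)
        (Set.range (Sum.elim (z i) (Sum.elim (fun l : {l // l ≠ l₀} => w i l) (G i)))) := by
  classical
  have hhom : ∀ᶠ i in U, ∀ j, (Sum.elim (w i) (G i) j).IsHomogeneous (Sum.elim a e j) := by
    filter_upwards [hw, hG.1] with i h1 h2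
    rintro (l | j)
    · exact h1 l
    · exact h2 j
  obtain ⟨k, hk⟩ : ∃ k, ¬∀ᶠ i in U, ∀ (n : ℕ) (c : L ⊕ J → K i), c ≠ 0 →
      (∀ j, c j ≠ 0 → Sum.elim a e j = n) →
      ¬HasCollapse n k (∑ j, c j • Sum.elim (w i) (G i) j) := by
    by_contra! hcon
    exact hS ⟨hhom, hcon⟩
  rw [← Ultrafilter.eventually_not] at hk
  have h1 : ∀ᶠ i in U, ∃ l₀ : L, ∃ c : L ⊕ J → K i, c (Sum.inl l₀) ≠ 0 ∧
      (∀ j, c j ≠ 0 → Sum.elim a e j = a l₀) ∧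
      HasCollapse (a l₀) k (∑ j, c j • Sum.elim (w i) (G i) j) := by
    filter_upwards [hk, hG.2 k] with i hi hGi
    push Not at hi
    obtain ⟨n, c, hc, hn, hcol⟩ := hi
    by_cases h0 : ∃ l, c (Sum.inl l) ≠ 0
    · obtain ⟨l, hl⟩ := h0
      obtain rfl : a l = n := hn _ hl
      exact ⟨l, c, hl, hn, hcol⟩
    · push Not at h0
      refine (hGi n (c ∘ Sum.inr) (fun hz => hc ?_) (fun j hj => hn _ hj) ?_).elim
      · funext j
        rcases j with l | j
        · exact h0 l
        · exact congrFun hz j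
      · simpa [Fintype.sum_sum_type, h0] using hcol
  obtain ⟨l₀, h2⟩ := Ultrafilter.eventually_exists_iff.1 h1
  have h3 : ∀ᶠ i in U, ∃ d : Fin k → Fin (a l₀), ∃ z : Fin k ⊕ Fin k → MvPolynomial (σ i) (K i),
      (∀ q, 0 < (d q : ℕ)) ∧ (∀ q, (z q).IsHomogeneous (Sum.elim (fun q => (d q : ℕ)) (fun q => a l₀ - d q) q)) ∧
      w i l₀ ∈ Algebra.adjoin (K i)
        (Set.range (Sum.elim z (Sum.elim (fun l : {l // l ≠ l₀} => w i l) (G i)))) := by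
    filter_upwards [h2, hhom] with i ⟨c, hc, hn, P, d, hP, hF⟩ hhi
    have hFn : (∑ j, c j • Sum.elim (w i) (G i) j).IsHomogeneous (a l₀) := by
      refine IsHomogeneous.sum _ _ _ fun j _ => ?_
      by_cases hj : c j = 0
      · rw [hj, zero_smul]
        exact isHomogeneous_zero _ _ _
      · rw [← hn j hj, smul_eq_C_mul]
        exact (hhi j).C_mul _
    obtain ⟨Q, hQ, hFQ⟩ := exists_homogeneous_coeffs (fun m => (hP m).2.1.le)
      (fun m => (hP m).2.2) hFn hF
    refine ⟨fun q => ⟨d q, (hP q).2.1⟩, Sum.elim P Q, fun q => (hP q).1, ?_, ?_⟩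
    · rintro (q | q)
      · exact (hP q).2.2
      · exact hQ q
    · set S := Algebra.adjoin (K i) (Set.range
        (Sum.elim (Sum.elim P Q) (Sum.elim (fun l : {l // l ≠ l₀} => w i l) (G i))))
      have hmem : ∀ q, Sum.elim (Sum.elim P Q)
          (Sum.elim (fun l : {l // l ≠ l₀} => w i l) (G i)) q ∈ S := fun q =>
        Algebra.subset_adjoin ⟨q, rfl⟩
      have h5 : c (Sum.inl l₀) • w i l₀ = ∑ m, Q m * P m -
          ∑ j ∈ Finset.univ.erase (Sum.inl l₀), c j • Sum.elim (w i) (G i) j := by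
        rw [← hFQ, ← Finset.add_sum_erase _ _ (Finset.mem_univ (Sum.inl l₀))]
        simp
      have h6 : c (Sum.inl l₀) • w i l₀ ∈ S := by
        rw [h5]
        refine sub_mem (sum_mem fun m _ => mul_mem (hmem (Sum.inl (Sum.inr m)))
          (hmem (Sum.inl (Sum.inl m)))) (sum_mem fun j hj => S.smul_mem ?_ _)
        rcases j with l | j
        · exact hmem (Sum.inr (Sum.inl ⟨l, fun h => by simp [h] at hj⟩))
        · exact hmem (Sum.inr (Sum.inr j))
      simpa [smul_smul, hc] using S.smul_mem h6 (c (Sum.inl l₀))⁻¹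
  obtain ⟨d, h4⟩ := Ultrafilter.eventually_exists_iff.1 h3
  obtain ⟨z, hz⟩ := h4.dchoice
  have hd : ∀ q, 0 < (d q : ℕ) := by
    obtain ⟨i, hi⟩ := hz.exists
    exact hi.1
  refine ⟨l₀, Fin k ⊕ Fin k, inferInstance, _, z, ?_, hz.mono fun i hi => hi.2.1,
    hz.mono fun i hi => hi.2.2⟩
  rintro (q | q)
  · exact (d q).2
  · exact Nat.sub_lt ((Nat.zero_le _).trans_lt (d q).2) (hd q)

/-- Relative small subalgebras: finitely many forms of bounded degree lie in the subalgebra generated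
by a strong family extending a given strong family. -/
theorem IsStrongFamily.exists_extension (hG : IsStrongFamily U e G) (D : ℕ) {L : Type} [Fintype L]
    {a : L → ℕ} {w : ∀ i, L → MvPolynomial (σ i) (K i)} (ha : ∀ l, a l ≤ D)
    (hw : ∀ᶠ i in U, ∀ l, (w i l).IsHomogeneous (a l)) :
    ∃ (M : Type) (_ : Fintype M) (g : M → ℕ) (y : ∀ i, M → MvPolynomial (σ i) (K i)),
      (∀ m, 0 < g m ∧ g m ≤ D) ∧
      IsStrongFamily U (Sum.elim g e) (fun i => Sum.elim (y i) (G i)) ∧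
      ∀ᶠ i in U, ∀ l, w i l ∈ Algebra.adjoin (K i) (Set.range (Sum.elim (y i) (G i))) := by
  classical
  obtain ⟨s, hs⟩ : ∃ s : Multiset ℕ, s = Finset.univ.val.map a := ⟨_, rfl⟩
  induction s using (WellFounded.cutExpand (Nat.lt_wfRel.wf)).induction generalizing L with
  | h s ih =>
  have step : ∀ (l₀ : L) (Q : Type) [Fintype Q] (b : Q → ℕ)
      (z : ∀ i, Q → MvPolynomial (σ i) (K i)), (∀ q, b q < a l₀) →
      (∀ᶠ i in U, ∀ q, (z i q).IsHomogeneous (b q)) →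
      (∀ᶠ i in U, w i l₀ ∈ Algebra.adjoin (K i)
        (Set.range (Sum.elim (z i) (Sum.elim (fun l : {l // l ≠ l₀} => w i l) (G i))))) →
      ∃ (M : Type) (_ : Fintype M) (g : M → ℕ) (y : ∀ i, M → MvPolynomial (σ i) (K i)),
      (∀ m, 0 < g m ∧ g m ≤ D) ∧
      IsStrongFamily U (Sum.elim g e) (fun i => Sum.elim (y i) (G i)) ∧
      ∀ᶠ i in U, ∀ l, w i l ∈ Algebra.adjoin (K i) (Set.range (Sum.elim (y i) (G i))) := by
    intro l₀ Q _ b z hb hz hmem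
    have hcut : Relation.CutExpand (· < ·)
        (Finset.univ.val.map (Sum.elim b fun l : {l // l ≠ l₀} => a l)) s := by
      refine ⟨Finset.univ.val.map b, a l₀, fun x hx => ?_, ?_⟩
      · obtain ⟨q, -, rfl⟩ := Multiset.mem_map.1 hx
        exact hb q
      · rw [hs, map_sumElim_univ_add_singleton]
    obtain ⟨M, hM, g, y, hg, hy, h⟩ := ih _ hcut
      (w := fun i => Sum.elim (z i) (fun l : {l // l ≠ l₀} => w i l))
      (Sum.rec (fun q => (hb q).le.trans (ha l₀)) fun l => ha l)
      (by filter_upwards [hz, hw] with i h1 h2 using Sum.rec h1 fun l => h2 l) rfl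
    refine ⟨M, hM, g, y, hg, hy, ?_⟩
    filter_upwards [h, hmem] with i h1 h2 l
    by_cases hl : l = l₀
    · subst hl
      refine Algebra.adjoin_le ?_ h2
      rintro _ ⟨q | l' | j, rfl⟩
      · exact h1 (Sum.inl q)
      · exact h1 (Sum.inr l')
      · exact Algebra.subset_adjoin ⟨Sum.inr j, rfl⟩
    · exact h1 (Sum.inr ⟨l, hl⟩)
  by_cases h0 : ∃ l, a l = 0
  · obtain ⟨l₀, hl₀⟩ := h0
    refine step l₀ Empty nofun nofun nofun (.of_forall fun _ => nofun) ?_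
    filter_upwards [hw] with i hi
    have h1 := hi l₀
    rw [hl₀] at h1
    rw [totalDegree_eq_zero_iff_eq_C.1 ((totalDegree_zero_iff_isHomogeneous _).2 h1)]
    exact Subalgebra.algebraMap_mem _ _
  · by_cases hS : IsStrongFamily U (Sum.elim a e) (fun i => Sum.elim (w i) (G i))
    · push Not at h0
      exact ⟨L, inferInstance, a, w, fun l => ⟨Nat.pos_of_ne_zero (h0 l), ha l⟩, hS,
        .of_forall fun i l => Algebra.subset_adjoin ⟨Sum.inl l, rfl⟩⟩
    · obtain ⟨l₀, Q, _, b, z, hb, hz, h⟩ := hG.exists_collapse hw hS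
      exact step l₀ Q b z hb hz h
end

theorem MvPolynomial.IsWeightedHomogeneous.isHomogeneous_aeval {K σ M : Type*} [CommRing K]
    {y : M → MvPolynomial σ K} {g : M → ℕ} (hy : ∀ m, (y m).IsHomogeneous (g m))
    {c : MvPolynomial M K} {n : ℕ} (hc : IsWeightedHomogeneous g c n) :
    (aeval y c).IsHomogeneous n := by
  rw [c.as_sum, map_sum]
  refine IsHomogeneous.sum _ _ _ fun d hd => ?_
  rw [aeval_monomial, algebraMap_eq, ← hc (mem_support_iff.1 hd), Finsupp.weight_apply]
  refine IsHomogeneous.C_mul (IsHomogeneous.prod _ _ _ fun m _ => ?_) _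
  simpa [mul_comm] using (hy m).pow (d m)

theorem exists_isWeightedHomogeneous_aeval_eq {K σ M : Type*} [CommRing K]
    {y : M → MvPolynomial σ K} {g : M → ℕ} (hy : ∀ m, (y m).IsHomogeneous (g m))
    {F : MvPolynomial σ K} {n : ℕ} (hF : F.IsHomogeneous n)
    (hmem : F ∈ Algebra.adjoin K (Set.range y)) :
    ∃ c : MvPolynomial M K, IsWeightedHomogeneous g c n ∧ aeval y c = F := by
  classical
  rw [Algebra.adjoin_range_eq_range_aeval] at hmem
  obtain ⟨c, rfl⟩ := hmem
  refine ⟨weightedHomogeneousComponent g n c,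
    weightedHomogeneousComponent_isWeightedHomogeneous n c, ?_⟩
  have h1 : homogeneousComponent n (aeval y c) = aeval y c := by
    exact (homogeneousComponent_of_mem hF).trans (if_pos rfl)
  change _ = aeval y c
  conv_rhs => rw [← h1]
  rw [weightedHomogeneousComponent_apply]
  conv_rhs => rw [c.as_sum]
  rw [map_sum, map_sum, map_sum, Finset.sum_filter]
  refine Finset.sum_congr rfl fun m _ => ?_
  have h2 : (aeval y (monomial m (coeff m c))).IsHomogeneous (Finsupp.weight g m) :=
    IsWeightedHomogeneous.isHomogeneous_aeval hy (isWeightedHomogeneous_monomial _ _ _ rfl)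
  rw [homogeneousComponent_of_mem h2]
  simp [eq_comm]

theorem coeff_coeff_sumAlgEquiv {K M M' : Type*} [CommRing K] (c : MvPolynomial (M' ⊕ M) K)
    (μ : M' →₀ ℕ) (ν : M →₀ ℕ) :
    coeff ν (coeff μ (sumAlgEquiv K M' M c)) = coeff (μ.sumElim ν) c := by
  simp only [sumAlgEquiv, coeff, AlgEquiv.trans_apply]
  trans (AddMonoidAlgebra.domCongr K K Finsupp.sumFinsuppAddEquivProdFinsupp c).coeff (μ, ν)
  · rfl
  · rw [AddMonoidAlgebra.coeff_domCongr]
    rfl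

theorem aeval_mem_span_of_coeff_eq_zero {K σ M M' : Type*} [CommRing K]
    (G : M' ⊕ M → MvPolynomial σ K) {x : MvPolynomial (M' ⊕ M) K}
    (hx : ∀ μ : M' →₀ ℕ, coeff (μ.sumElim 0) x = 0) :
    aeval G x ∈ Ideal.span (Set.range (G ∘ Sum.inr)) := by
  rw [x.as_sum, map_sum]
  refine sum_mem fun d hd => ?_
  by_cases h : ∃ m, d (Sum.inr m) ≠ 0
  · obtain ⟨m, hm⟩ := h
    rw [aeval_monomial]
    refine Ideal.mul_mem_left _ _ (Ideal.mem_of_dvd _ ?_ (Ideal.subset_span ⟨m, rfl⟩))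
    exact (dvd_pow_self _ hm).trans
      (Finset.dvd_prod_of_mem (fun i => G i ^ d i) (Finsupp.mem_support_iff.2 hm))
  · push Not at h
    refine (mem_support_iff.1 hd ?_).elim
    rw [← hx (d.comapDomain Sum.inl Sum.inl_injective.injOn)]
    congr 1
    ext (m | m)
    · rfl
    · exact h m

theorem height_comap_C_add_one_le {σ T : Type*} [Finite σ] [CommRing T] [IsNoetherianRing T]
    (Q : Ideal (MvPolynomial σ T)) [Q.IsPrime] {x : MvPolynomial σ T} (hx : x ∈ Q) {μ : σ →₀ ℕ}
    (hμ : coeff μ x ∉ Q.comap C) : (Q.comap C).height + 1 ≤ Q.height := by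
  set p := Q.comap (C : T →+* MvPolynomial σ T) with hp
  have : p.IsPrime := Ideal.comap_isPrime _ _
  have hker : p.map C = RingHom.ker (map (Ideal.Quotient.mk p) : MvPolynomial σ T →+* _) := by
    rw [MvPolynomial.ker_map, Ideal.mk_ker]
  have : (p.map (C : T →+* MvPolynomial σ T)).IsPrime := hker ▸ RingHom.ker_isPrime _
  have h1 : p.map C < Q := by
    refine (Ideal.map_comap_le).lt_of_ne fun h => hμ ?_
    rw [← h, mem_map_C_iff] at hx
    exact hx μ
  refine le_trans ?_ (Ideal.height_add_one_le_of_lt_of_isPrime h1)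
  have : (p.map (C : T →+* MvPolynomial σ T)).LiesOver p := ⟨by
    refine le_antisymm Ideal.le_comap_map ?_
    exact Ideal.comap_mono Ideal.map_comap_le⟩
  gcongr
  rw [Ideal.height_eq_height_add_of_liesOver_of_hasGoingDown p (p.map C)]
  exact le_self_add

theorem height_comap_aeval_add_one_le {K σ M M' : Type*} [Field K] [Finite M] [Finite M']
    {P : Ideal (MvPolynomial σ K)} [P.IsPrime] (y' : M' → MvPolynomial σ K)
    (y : M → MvPolynomial σ K) {c : MvPolynomial (M' ⊕ M) K}
    (hc : aeval (Sum.elim y' y) c ∈ P) {μ : M' →₀ ℕ}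
    (hμ : aeval y (coeff μ (sumAlgEquiv K M' M c)) ∉ P) :
    (P.comap (aeval y : MvPolynomial M K →ₐ[K] MvPolynomial σ K)).height + 1 ≤
      (P.comap (aeval (Sum.elim y' y) : MvPolynomial (M' ⊕ M) K →ₐ[K] MvPolynomial σ K)).height := by
  set p' := P.comap (aeval (Sum.elim y' y) : MvPolynomial (M' ⊕ M) K →ₐ[K] MvPolynomial σ K)
  have : p'.IsPrime := Ideal.comap_isPrime _ _
  let E := (sumAlgEquiv K M' M).symm
  have h1 : (p'.comap E.toRingEquiv).comap C =
      P.comap (aeval y : MvPolynomial M K →ₐ[K] MvPolynomial σ K) := by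
    ext x
    simp only [Ideal.mem_comap, p']
    refine iff_of_eq (congrArg (· ∈ P) ?_)
    induction x using MvPolynomial.induction_on with
    | C a => simp [E]
    | add a b ha hb => simp only [map_add, ha, hb]
    | mul_X a m ha => rw [C_mul, map_mul, map_mul, ha]; simp [E]
  have h2 := height_comap_C_add_one_le (p'.comap E.toRingEquiv)
    (x := sumAlgEquiv K M' M c) (μ := μ) ?_ ?_
  · rwa [RingEquiv.height_comap, h1] at h2
  · simpa [E, p', Ideal.mem_comap] using hc
  · rwa [h1]

theorem exists_fin_of_not_jacInd {K σ J : Type*} [Field K] [Fintype J]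
    {P : Ideal (MvPolynomial σ K)} [P.IsPrime] {f : J → MvPolynomial σ K} (h : ¬JacInd P f) :
    ∃ (ρ : ℕ) (v : Fin ρ → σ), ρ < Fintype.card J ∧ ∀ a : J → MvPolynomial σ K,
      (∀ l, ∑ j, a j * pderiv (v l) (f j) ∈ P) → ∀ w, ∑ j, a j * pderiv w (f j) ∈ P := by
  classical
  set L := FractionRing (MvPolynomial σ K ⧸ P)
  set q : MvPolynomial σ K →+* L := (algebraMap _ L).comp (Ideal.Quotient.mk P) with hqdef
  have hq : ∀ x, q x = 0 ↔ x ∈ P := fun x => by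
    rw [hqdef, RingHom.comp_apply, FaithfulSMul.algebraMap_eq_zero_iff,
      Ideal.Quotient.eq_zero_iff_mem]
  let A : σ → Submodule L (J → L) := fun w =>
    LinearMap.ker (Fintype.linearCombination L fun j => q (pderiv w (f j)))
  have hA : ∀ (a : J → MvPolynomial σ K) w,
      (fun j => q (a j)) ∈ A w ↔ ∑ j, a j * pderiv w (f j) ∈ P := fun a w => by
    rw [← hq, map_sum]
    simp [A, Fintype.linearCombination_apply]
  obtain ⟨ρ, v, hρ, hv⟩ := Submodule.exists_fin_iInf_eq A
  refine ⟨ρ, v, ?_, fun a ha w => ?_⟩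
  · simp only [JacInd, not_forall] at h
    obtain ⟨a, ha, j, hj⟩ := h
    have h1 : (fun j => q (a j)) ∈ ⨅ w, A w := (Submodule.mem_iInf _).2 fun w => (hA a w).2 (ha w)
    have h2 : 0 < Module.finrank L ↥(⨅ w, A w) := by
      rw [Module.finrank_pos_iff_exists_ne_zero]
      exact ⟨⟨_, h1⟩, fun h0 => hj ((hq _).1 (congrFun (congrArg Subtype.val h0) j))⟩
    rw [Module.finrank_fintype_fun_eq_card] at hρ
    omega
  · have h1 : (fun j => q (a j)) ∈ ⨅ w, A w := by
      rw [← hv]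
      exact (Submodule.mem_iInf _).2 fun l => (hA a _).2 (ha l)
    exact (hA a w).1 ((Submodule.mem_iInf _).1 h1 w)

theorem Ideal.IsPrime.exists_kernel_vector {T I J : Type*} [CommRing T] [Fintype I] [Fintype J]
    (p : Ideal T) [p.IsPrime] (c : I → J → T) (h : Fintype.card I < Fintype.card J) :
    ∃ a : J → T, (∃ j, a j ∉ p) ∧ ∀ l, ∑ j, a j * c l j ∈ p := by
  set L := FractionRing (T ⧸ p)
  set q : T →+* L := (algebraMap _ L).comp (Ideal.Quotient.mk p) with hqdef
  have hq : ∀ x, q x = 0 ↔ x ∈ p := fun x => by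
    rw [hqdef, RingHom.comp_apply, FaithfulSMul.algebraMap_eq_zero_iff,
      Ideal.Quotient.eq_zero_iff_mem]
  have hker := LinearMap.ker_ne_bot_of_finrank_lt
    (f := Fintype.linearCombination L fun (j : J) (l : I) => q (c l j)) (by simpa using h)
  obtain ⟨x, hx, hx0⟩ := Submodule.exists_mem_ne_zero_of_ne_bot hker
  obtain ⟨s, hs, a, ha⟩ := Ideal.IsPrime.exists_common_denominator p x
  have ha : ∀ j, q (a j) = q s * x j := ha
  obtain ⟨j, hj⟩ := Function.ne_iff.1 hx0
  refine ⟨a, ⟨j, fun hmem => ?_⟩, fun l => ?_⟩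
  · rw [← hq, ha] at hmem
    exact (mul_ne_zero (mt (hq s).1 hs) hj) hmem
  · have := congrFun hx l
    simp only [Fintype.linearCombination_apply, Finset.sum_apply, Pi.smul_apply,
      smul_eq_mul, Pi.zero_apply] at this
    rw [← hq, map_sum]
    simp_rw [map_mul, ha, mul_assoc, ← Finset.mul_sum, this, mul_zero]

theorem exists_fin_trivial_kernel {K σ J : Type*} [Field K] [Fintype J]
    (I : Ideal (MvPolynomial σ K)) (f : J → MvPolynomial σ K) (e : J → ℕ)
    (h : ∀ (n : ℕ) (c : J → K), (∀ j, c j ≠ 0 → e j = n) →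
      (∀ v, pderiv v (∑ j, c j • f j) ∈ I) → c = 0) :
    ∃ (ρ : ℕ) (v : Fin ρ → σ), ρ ≤ Fintype.card J ∧ ∀ (n : ℕ) (c : J → K),
      (∀ j, c j ≠ 0 → e j = n) → (∀ l, pderiv (v l) (∑ j, c j • f j) ∈ I) → c = 0 := by
  classical
  let D : σ → ℕ → (J → K) →ₗ[K] MvPolynomial σ K := fun v n =>
    Fintype.linearCombination K fun j => if e j = n then pderiv v (f j) else 0
  let A : σ → Submodule K (J → K) := fun v =>
    ⨅ n, (I.restrictScalars K).comap (D v n)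
  have hD : ∀ v n (c : J → K), D v n c = pderiv v (∑ j, (if e j = n then c j else 0) • f j) := by
    intro v n c
    simp only [D, Fintype.linearCombination_apply, map_sum, Derivation.map_smul]
    exact Finset.sum_congr rfl fun j _ => by split_ifs <;> simp
  obtain ⟨ρ, v, hρ, hv⟩ := Submodule.exists_fin_iInf_eq A
  have hbot : ⨅ w, A w = ⊥ := by
    rw [eq_bot_iff]
    intro c hc
    simp only [A, Submodule.mem_iInf, Submodule.mem_comap, hD] at hc
    funext j
    have := congrFun (h (e j) (fun j' => if e j' = e j then c j' else 0) (fun j' hj' => by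
      by_contra hne
      simp [hne] at hj') fun w => hc w (e j)) j
    simpa using this
  refine ⟨ρ, v, ?_, fun n c hn hc => ?_⟩
  · rw [Module.finrank_fintype_fun_eq_card] at hρ
    omega
  · rw [← Submodule.mem_bot K, ← hbot, ← hv]
    simp only [A, Submodule.mem_iInf, Submodule.mem_comap, hD]
    intro l m
    by_cases hm : m = n
    · subst hm
      have : ∑ j, (if e j = m then c j else 0) • f j = ∑ j, c j • f j := by
        refine Finset.sum_congr rfl fun j _ => ?_
        by_cases hj : c j = 0
        · simp [hj]
        · simp [hn j hj]
      rw [this]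
      exact hc l
    · have : ∑ j, (if e j = m then c j else 0) • f j = 0 := by
        refine Finset.sum_eq_zero fun j _ => ?_
        by_cases hj : c j = 0
        · simp [hj]
        · simp [hn j hj, Ne.symm hm]
      rw [this, map_zero]
      exact zero_mem _

theorem height_comap_aeval_add_one_le_of_kernel {K σ J M' M : Type*} [Field K] [Fintype J]
    [Finite M'] [Finite M] {P : Ideal (MvPolynomial σ K)} [P.IsPrime]
    {f : J → MvPolynomial σ K} {e : J → ℕ} (he : ∀ j, 1 ≤ e j)
    {y' : M' → MvPolynomial σ K} {y : M → MvPolynomial σ K} {g' : M' → ℕ} {g : M → ℕ}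
    (hg : ∀ m, 0 < g m) {ρ : ℕ} {v : Fin ρ → σ} {c : Fin ρ → J → MvPolynomial (M' ⊕ M) K}
    (hc : ∀ l j, IsWeightedHomogeneous (Sum.elim g' g) (c l j) (e j - 1))
    (hcf : ∀ l j, aeval (Sum.elim y' y) (c l j) = pderiv (v l) (f j))
    (hker : ∀ (n : ℕ) (b : J → K), (∀ j, b j ≠ 0 → e j = n) →
      (∀ l, pderiv (v l) (∑ j, b j • f j) ∈ Ideal.span (Set.range y)) → b = 0)
    {a : J → MvPolynomial M K} (ha : ∃ j, aeval y (a j) ∉ P)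
    (haf : ∀ w, ∑ j, aeval y (a j) * pderiv w (f j) ∈ P) :
    (P.comap (aeval y : MvPolynomial M K →ₐ[K] MvPolynomial σ K)).height + 1 ≤
      (P.comap (aeval (Sum.elim y' y) :
        MvPolynomial (M' ⊕ M) K →ₐ[K] MvPolynomial σ K)).height := by
  classical
  by_contra hlt
  set p := P.comap (aeval y : MvPolynomial M K →ₐ[K] MvPolynomial σ K) with hp
  -- every coefficient relation over the small ring holds modulo `p`
  have hrel : ∀ l μ, ∑ j, a j * coeff μ (sumAlgEquiv K M' M (c l j)) ∈ p := by
    intro l μ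
    by_contra hμ
    refine hlt (height_comap_aeval_add_one_le y' y
      (c := ∑ j, rename Sum.inr (a j) * c l j) (μ := μ) ?_ ?_)
    · rw [map_sum]
      convert haf (v l) using 2 with j
      rw [map_mul, hcf, aeval_rename, Sum.elim_comp_inr]
    · convert hμ using 1
      rw [hp, Ideal.mem_comap]
      have : ∀ j, coeff μ (sumAlgEquiv K M' M (rename Sum.inr (a j) * c l j)) =
          a j * coeff μ (sumAlgEquiv K M' M (c l j)) := fun j => by
        rw [map_mul]
        have h := DFunLike.congr_fun (sumAlgEquiv_comp_rename_inr (R := K) (S₁ := M') (S₂ := M)) (a j)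
        simp only [AlgHom.comp_apply, AlgEquiv.coe_toAlgHom] at h
        erw [h]
        exact coeff_C_mul _ _ _
      rw [map_sum, coeff_sum, Finset.sum_congr rfl fun j _ => this j]
  have hw : ∀ (μ : M' →₀ ℕ) (ν : M →₀ ℕ), Finsupp.weight (Sum.elim g' g) (μ.sumElim ν) =
      Finsupp.weight g' μ + Finsupp.weight g ν := fun μ ν => by
    simp only [Finsupp.weight_apply]
    rw [Finsupp.sum_sumElim]
    rfl
  have hw0 : ∀ ν : M →₀ ℕ, ν ≠ 0 → Finsupp.weight g ν ≠ 0 := fun ν hν h0 => by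
    obtain ⟨m, hm⟩ := Finsupp.ne_iff.1 hν
    have h1 := Finsupp.le_weight g (hg m).ne' ν
    simp only [Finsupp.coe_zero, Pi.zero_apply] at hm
    omega
  have hstep : ∀ n, (∀ j, n < e j → a j ∈ p) → ∀ j, e j = n → a j ∈ p := by
    intro n hn j₀ hj₀
    rw [← Ideal.Quotient.eq_zero_iff_mem, ← Module.forall_dual_apply_eq_zero_iff K]
    intro φ
    have hb := hker n (fun j => if e j = n then φ (Ideal.Quotient.mk p (a j)) else 0)
      (fun j hj => by by_contra hne; simp [hne] at hj) fun l => by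
        have h1 : pderiv (v l) (∑ j, (if e j = n then φ (Ideal.Quotient.mk p (a j)) else 0) • f j) =
            aeval (Sum.elim y' y)
              (∑ j, (if e j = n then φ (Ideal.Quotient.mk p (a j)) else 0) • c l j) := by
          simp only [map_sum, Derivation.map_smul, map_smul, hcf]
        rw [h1, ← Sum.elim_comp_inr y' y]
        refine aeval_mem_span_of_coeff_eq_zero (Sum.elim y' y) fun μ => ?_
        rw [coeff_sum]
        simp only [coeff_smul, smul_eq_mul]
        by_cases hμ : Finsupp.weight g' μ = n - 1
        · have h2 := congrArg φ ((Ideal.Quotient.eq_zero_iff_mem).2 (hrel l μ))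
          rw [map_zero, map_sum, map_sum] at h2
          refine (Finset.sum_congr rfl fun j _ => ?_).trans h2
          rcases lt_trichotomy (e j) n with hlt | heq | hgt
          · have h3 : coeff μ (sumAlgEquiv K M' M (c l j)) = 0 := by
              ext ν
              rw [coeff_coeff_sumAlgEquiv, coeff_zero]
              refine (hc l j).coeff_eq_zero _ ?_
              rw [hw]
              have := he j
              omega
            simp [h3, hlt.ne]
          · have h3 : coeff μ (sumAlgEquiv K M' M (c l j)) =
                C (coeff (μ.sumElim 0) (c l j)) := by
              ext ν
              rw [coeff_coeff_sumAlgEquiv, coeff_C]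
              split_ifs with hν
              · rw [hν]
              · refine (hc l j).coeff_eq_zero _ ?_
                rw [hw]
                have := hw0 ν (Ne.symm hν)
                omega
            rw [h3, if_pos heq, mul_comm (a j), ← smul_eq_C_mul, ← Ideal.Quotient.mkₐ_eq_mk K,
              map_smul, map_smul, smul_eq_mul, mul_comm]
          · rw [if_neg hgt.ne', zero_mul, (Ideal.Quotient.eq_zero_iff_mem).2
              (p.mul_mem_right _ (hn j hgt)), map_zero]
        · refine Finset.sum_eq_zero fun j _ => ?_
          split_ifs with hj
          · rw [(hc l j).coeff_eq_zero _ (by rw [hw, map_zero, hj]; exact hμ), mul_zero]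
          · exact zero_mul _
    simpa [hj₀] using congrFun hb j₀
  have hmain : ∀ k j, (∑ j, e j) - e j = k → a j ∈ p := by
    intro k
    induction k using Nat.strong_induction_on with
    | _ k ih =>
      refine fun j hj => hstep _ (fun j' hj' => ih _ ?_ j' rfl) j rfl
      have := Finset.single_le_sum (f := e) (fun _ _ => Nat.zero_le _) (Finset.mem_univ j')
      omega
  obtain ⟨j, hj⟩ := ha
  exact hj (hmain _ j rfl)

theorem mem_span_subtype_of_isHomogeneous {K σ M : Type*} [CommRing K] [Fintype M] {n : ℕ}
    {F : MvPolynomial σ K} {y : M → MvPolynomial σ K} {g : M → ℕ}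
    (hy : ∀ m, (y m).IsHomogeneous (g m)) (hFn : F.IsHomogeneous n)
    (hF : F ∈ Ideal.span (Set.range y)) :
    F ∈ Ideal.span (Set.range fun m : {m // g m ≤ n} => y m) := by
  obtain ⟨c, hc⟩ := (Ideal.mem_span_range_iff_exists_fun).1 hF
  have h1 : homogeneousComponent n F = F := by
    rw [homogeneousComponent_of_mem hFn, if_pos rfl]
  rw [← h1, ← hc, map_sum]
  refine sum_mem fun m _ => ?_
  rw [← sum_homogeneousComponent (c m), Finset.sum_mul, map_sum]
  refine sum_mem fun k _ => ?_
  rw [homogeneousComponent_of_mem ((homogeneousComponent_isHomogeneous k (c m)).mul (hy m))]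
  split_ifs with h
  · exact Ideal.mul_mem_left _ _ (Ideal.subset_span ⟨⟨m, by omega⟩, rfl⟩)
  · exact zero_mem _

theorem hasCollapse_of_pderiv_mem_span {K : Type*} [Field K] [PerfectField K] {N r e : ℕ}
    {y : Fin r → MvPolynomial (Fin N) K} {g : Fin r → ℕ} (hg : ∀ m, 0 < g m ∧ g m < e)
    (hy : ∀ m, (y m).IsHomogeneous (g m))
    (hJ : ∀ P : Ideal (MvPolynomial (Fin N) K), P.IsPrime → P.height ≤ r + 1 → JacInd P y)
    {F : MvPolynomial (Fin N) K} (he : 0 < e) (hF : F.IsHomogeneous e)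
    (hdF : ∀ v, pderiv v F ∈ Ideal.span (Set.range y)) :
    HasCollapse e r F ∨ HasCollapse e (r + 1) F := by
  by_cases heK : (e : K) = 0
  · right
    obtain ⟨p, hp⟩ := CharP.exists K
    have hpe := (CharP.cast_eq_zero_iff K p e).1 heK
    rcases CharP.char_is_prime_or_zero K p with hp' | rfl
    · have : Fact p.Prime := ⟨hp'⟩
      have : ExpChar K p := ExpChar.prime hp'
      obtain ⟨e', rfl⟩ := hpe
      have h0 : ∀ j, constantCoeff (y j) = 0 := fun j => by
        rw [constantCoeff_eq]
        exact (hy j).coeff_eq_zero (by simpa using (hg j).1.ne)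
      obtain ⟨h, hh, hmem⟩ := exists_sub_pow_mem_span p hy h0 hJ hF hdF
      have he' : 0 < e' := Nat.pos_of_mul_pos_left he
      have h2 := hp'.two_le
      have := HasCollapse.of_mem_span (n := p * e') (F := F) (y := Sum.elim y fun _ : Unit => h)
        (g := Sum.elim g fun _ : Unit => e')
        (by
          rintro (m | m)
          · exact hg m
          · exact ⟨he', by simp only [Sum.elim_inr]; nlinarith⟩)
        (by
          rintro (m | m)
          · exact hy m
          · exact hh)
        (by
          rw [← sub_add_cancel F (h ^ p)]
          refine add_mem (Ideal.span_mono ?_ hmem) ?_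
          · rintro _ ⟨m, rfl⟩
            exact ⟨Sum.inl m, rfl⟩
          · have h3 : h ∈ Ideal.span (Set.range (Sum.elim y fun _ : Unit => h)) :=
              Ideal.subset_span ⟨Sum.inr (), rfl⟩
            exact Ideal.pow_mem_of_mem _ h3 _ hp'.pos)
      simpa using this
    · rw [zero_dvd_iff] at hpe
      omega
  · left
    have h1 : F ∈ Ideal.span (Set.range y) := by
      have h2 := hF.sum_X_mul_pderiv
      have h3 : F = C (e : K)⁻¹ * ∑ i, X i * pderiv i F := by
        rw [h2, nsmul_eq_mul, ← mul_assoc, ← C_eq_coe_nat, ← C_mul, inv_mul_cancel₀ heK, C_1,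
          one_mul]
      rw [h3]
      exact Ideal.mul_mem_left _ _ (sum_mem fun i _ => Ideal.mul_mem_left _ _ (hdF i))
    simpa using HasCollapse.of_mem_span hg hy h1

theorem IsStrongFamily.exists_hasCollapse_of_pderiv_mem_span {ι : Type*} {U : Ultrafilter ι}
    {K : ι → Type*} [∀ i, Field (K i)] [∀ i, PerfectField (K i)] {N : ι → ℕ} {M : Type} [Fintype M]
    {g : M → ℕ} {y : ∀ i, M → MvPolynomial (Fin (N i)) (K i)} (hys : IsStrongFamily U g y)
    (hg : ∀ m, 0 < g m)
    (hJ : ∀ (M' : Type) [Fintype M'] (f : M' → M), Function.Injective f → ∀ c : ℕ, ∀ᶠ i in U,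
      ∀ P : Ideal (MvPolynomial (Fin (N i)) (K i)), P.IsPrime → P.height ≤ c →
        JacInd P (y i ∘ f))
    {e : ℕ} (he : 0 < e) {F : ∀ i, MvPolynomial (Fin (N i)) (K i)}
    (hF : ∀ᶠ i in U, (F i).IsHomogeneous e)
    (hdF : ∀ᶠ i in U, ∀ v, pderiv v (F i) ∈ Ideal.span (Set.range (y i))) :
    ∃ k, ∀ᶠ i in U, HasCollapse e k (F i) := by
  set r := Fintype.card {m // g m ≤ e - 1}
  let f : Fin r → M := fun l => ((Fintype.equivFin {m // g m ≤ e - 1}).symm l).1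
  have hf : Function.Injective f := Subtype.val_injective.comp (Equiv.injective _)
  have hor : ∀ᶠ i in U, HasCollapse e r (F i) ∨ HasCollapse e (r + 1) (F i) := by
    filter_upwards [hF, hdF, hys.1, hJ _ f hf (r + 1)] with i h1 h2 h3 h4
    refine hasCollapse_of_pderiv_mem_span (y := y i ∘ f) (g := g ∘ f)
      (fun m => ⟨hg _, ?_⟩) (fun m => h3 _) (fun P hP hPr => h4 P hP (by exact_mod_cast hPr))
      he h1 fun v => ?_
    · have := ((Fintype.equivFin {m // g m ≤ e - 1}).symm m).2
      simp only [Function.comp_apply, f]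
      omega
    · have := mem_span_subtype_of_isHomogeneous h3 (h1.pderiv (i := v)) (h2 v)
      refine Ideal.span_mono ?_ this
      rintro _ ⟨m, rfl⟩
      exact ⟨Fintype.equivFin _ m, by simp [f]⟩
  rcases Ultrafilter.eventually_or.1 hor with h | h
  exacts [⟨_, h⟩, ⟨_, h⟩]

section

variable {ι : Type*} {U : Ultrafilter ι} {K : ι → Type*} [∀ i, Field (K i)]

theorem exists_isStrongFamily {σ : ι → Type*} (D : ℕ) {L : Type} [Fintype L] {a : L → ℕ}
    {w : ∀ i, L → MvPolynomial (σ i) (K i)} (ha : ∀ l, a l ≤ D)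
    (hw : ∀ᶠ i in U, ∀ l, (w i l).IsHomogeneous (a l)) :
    ∃ (M : Type) (_ : Fintype M) (g : M → ℕ) (y : ∀ i, M → MvPolynomial (σ i) (K i)),
      (∀ m, 0 < g m ∧ g m ≤ D) ∧ IsStrongFamily U g y ∧
      ∀ᶠ i in U, ∀ l, w i l ∈ Algebra.adjoin (K i) (Set.range (y i)) := by
  have h0 : IsStrongFamily U (Empty.elim : Empty → ℕ)
      (fun i => (Empty.elim : Empty → MvPolynomial (σ i) (K i))) :=
    ⟨.of_forall fun _ j => j.elim,
      fun _ => .of_forall fun _ _ c hc => absurd (Subsingleton.elim c 0) hc⟩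
  obtain ⟨M, _, g, y, hg, hs, hmem⟩ := h0.exists_extension D ha hw
  refine ⟨M, _, g, y, hg, hs.comp_injective Sum.inl_injective, hmem.mono fun i hi l => ?_⟩
  refine Algebra.adjoin_mono ?_ (hi l)
  rintro _ ⟨m | m, rfl⟩
  · exact ⟨m, rfl⟩
  · exact m.elim

variable {N : ι → ℕ} {P : ∀ i, Ideal (MvPolynomial (Fin (N i)) (K i))} [∀ i, (P i).IsPrime]
  {J : Type} [Fintype J] {e : J → ℕ} {f : ∀ i, J → MvPolynomial (Fin (N i)) (K i)} {d : ℕ}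

theorem exists_relation_of_not_jacInd (he : ∀ j, e j ≤ d + 1)
    (hf : ∀ᶠ i in U, ∀ j, (f i j).IsHomogeneous (e j))
    (h : ∀ᶠ i in U, ¬JacInd (P i) (f i)) :
    ∃ (M : Type) (_ : Fintype M) (g : M → ℕ) (y : ∀ i, M → MvPolynomial (Fin (N i)) (K i)),
      (∀ m, 0 < g m ∧ g m ≤ d) ∧ IsStrongFamily U g y ∧
      ∀ᶠ i in U, ∃ a : J → MvPolynomial M (K i), (∃ j, aeval (y i) (a j) ∉ P i) ∧
        ∀ v, ∑ j, aeval (y i) (a j) * pderiv v (f i j) ∈ P i := by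
  have h1 : ∀ᶠ i in U, ∃ ρ : Fin (Fintype.card J),
      ∃ w : Fin ρ × J → MvPolynomial (Fin (N i)) (K i), ∃ v : Fin ρ → Fin (N i),
        (∀ q, w q = pderiv (v q.1) (f i q.2)) ∧ ∀ a : J → MvPolynomial (Fin (N i)) (K i),
          (∀ l, ∑ j, a j * pderiv (v l) (f i j) ∈ P i) → ∀ u, ∑ j, a j * pderiv u (f i j) ∈ P i := by
    filter_upwards [h] with i hi
    obtain ⟨ρ, v, hρ, hv⟩ := exists_fin_of_not_jacInd hi
    exact ⟨⟨ρ, hρ⟩, _, v, fun _ => rfl, hv⟩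
  obtain ⟨ρ, h2⟩ := Ultrafilter.eventually_exists_iff.1 h1
  obtain ⟨w, hw⟩ := h2.dchoice
  obtain ⟨M, _, g, y, hg, hs, hmem⟩ := exists_isStrongFamily (U := U) (w := w) d
    (a := fun q => e q.2 - 1) (fun q => by have := he q.2; omega) (by
      filter_upwards [hf, hw] with i h3 h4 q
      obtain ⟨v, hv, -⟩ := h4
      rw [hv]
      exact (h3 _).pderiv)
  refine ⟨M, _, g, y, hg, hs, ?_⟩
  filter_upwards [hw, hmem] with i h3 h4
  obtain ⟨v, hv, hP⟩ := h3
  simp_rw [Algebra.adjoin_range_eq_range_aeval] at h4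
  choose c hc using fun q => h4 q
  have hc : ∀ q, aeval (y i) (c q) = w i q := hc
  have hp : ((P i).comap (aeval (y i) : MvPolynomial M (K i) →ₐ[K i] _)).IsPrime :=
    Ideal.comap_isPrime _ _
  obtain ⟨a, ha, hac⟩ := hp.exists_kernel_vector _ (fun l j => c (l, j))
    (by simp)
  refine ⟨a, ha, hP _ fun l => ?_⟩
  have := hac l
  rw [Ideal.mem_comap, map_sum] at this
  simpa only [map_mul, hc, hv] using this

variable [∀ i, PerfectField (K i)]

theorem exists_relation_of_relation (he : ∀ j, 1 ≤ e j ∧ e j ≤ d + 1) (hf : IsStrongFamily U e f)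
    {M : Type} [Fintype M] {g : M → ℕ} {y : ∀ i, M → MvPolynomial (Fin (N i)) (K i)}
    (hg : ∀ m, 0 < g m ∧ g m ≤ d) (hy : IsStrongFamily U g y)
    (hJ : ∀ c : ℕ, ∀ᶠ i in U, ∀ P : Ideal (MvPolynomial (Fin (N i)) (K i)), P.IsPrime →
      P.height ≤ c → JacInd P (y i)) {n : ℕ}
    (h : ∀ᶠ i in U, ∃ a : J → MvPolynomial M (K i), (∃ j, aeval (y i) (a j) ∉ P i) ∧
      (∀ v, ∑ j, aeval (y i) (a j) * pderiv v (f i j) ∈ P i) ∧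
      n ≤ ((P i).comap (aeval (y i) : MvPolynomial M (K i) →ₐ[K i] _)).height) :
    ∃ (M : Type) (_ : Fintype M) (g : M → ℕ) (y : ∀ i, M → MvPolynomial (Fin (N i)) (K i)),
      (∀ m, 0 < g m ∧ g m ≤ d) ∧ IsStrongFamily U g y ∧
      ∀ᶠ i in U, ∃ a : J → MvPolynomial M (K i), (∃ j, aeval (y i) (a j) ∉ P i) ∧
        (∀ v, ∑ j, aeval (y i) (a j) * pderiv v (f i j) ∈ P i) ∧
        (n + 1 : ℕ) ≤ ((P i).comap (aeval (y i) : MvPolynomial M (K i) →ₐ[K i] _)).height := by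
  -- no combination of the forms of one degree has all its partial derivatives in `(y)`
  have hB : ∀ᶠ i in U, ∀ (n : ℕ) (c : J → K i), (∀ j, c j ≠ 0 → e j = n) →
      (∀ v, pderiv v (∑ j, c j • f i j) ∈ Ideal.span (Set.range (y i))) → c = 0 := by
    by_contra hA
    rw [← Ultrafilter.eventually_not] at hA
    have h1 : ∀ᶠ i in U, ∃ j₀ : J, ∃ c : J → K i, c ≠ 0 ∧ (∀ j, c j ≠ 0 → e j = e j₀) ∧
        ∀ v, pderiv v (∑ j, c j • f i j) ∈ Ideal.span (Set.range (y i)) := by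
      filter_upwards [hA] with i hi
      push Not at hi
      obtain ⟨n, c, hn, hc, hc0⟩ := hi
      obtain ⟨j₀, hj₀⟩ := Function.ne_iff.1 hc0
      exact ⟨j₀, c, hc0, fun j hj => (hn j hj).trans (hn j₀ hj₀).symm, hc⟩
    obtain ⟨j₀, h2⟩ := Ultrafilter.eventually_exists_iff.1 h1
    obtain ⟨c, hc⟩ := h2.dchoice
    obtain ⟨k, hk⟩ := hy.exists_hasCollapse_of_pderiv_mem_span (fun m => (hg m).1)
      (fun M' _ f' hf' b => (hJ b).mono fun i hi P hP hb => (hi P hP hb).comp_injective hf')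
      (he j₀).1 (F := fun i => ∑ j, c i j • f i j)
      (by
        filter_upwards [hc, hf.1] with i h3 h4
        refine IsHomogeneous.sum _ _ _ fun j _ => ?_
        by_cases hj : c i j = 0
        · simp [hj, isHomogeneous_zero]
        · rw [← h3.2.1 j hj, smul_eq_C_mul]
          exact (h4 j).C_mul _)
      (hc.mono fun i hi => hi.2.2)
    obtain ⟨i, h3, h4, h5⟩ := (hk.and (hc.and (hf.2 k))).exists
    exact h5 _ _ h4.1 h4.2.1 h3
  have h1 : ∀ᶠ i in U, ∃ ρ : Fin (Fintype.card J + 1),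
      ∃ w : Fin ρ × J → MvPolynomial (Fin (N i)) (K i), ∃ v : Fin ρ → Fin (N i),
        (∀ q, w q = pderiv (v q.1) (f i q.2)) ∧ ∀ (n : ℕ) (c : J → K i),
          (∀ j, c j ≠ 0 → e j = n) →
          (∀ l, pderiv (v l) (∑ j, c j • f i j) ∈ Ideal.span (Set.range (y i))) → c = 0 := by
    filter_upwards [hB] with i hi
    obtain ⟨ρ, v, hρ, hv⟩ := exists_fin_trivial_kernel _ _ _ hi
    exact ⟨⟨ρ, by omega⟩, _, v, fun _ => rfl, hv⟩
  obtain ⟨ρ, h2⟩ := Ultrafilter.eventually_exists_iff.1 h1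
  obtain ⟨w, hw⟩ := h2.dchoice
  have hwhom : ∀ᶠ i in U, ∀ q, (w i q).IsHomogeneous (e q.2 - 1) := by
    filter_upwards [hf.1, hw] with i h3 h4 q
    obtain ⟨v, hv, -⟩ := h4
    rw [hv]
    exact (h3 _).pderiv
  obtain ⟨M', _, g', y', hg', hs, hmem⟩ := hy.exists_extension d (w := w)
    (a := fun q => e q.2 - 1) (fun q => by have := he q.2; omega) hwhom
  refine ⟨M' ⊕ M, inferInstance, Sum.elim g' g, fun i => Sum.elim (y' i) (y i), ?_, hs, ?_⟩
  · rintro (m | m)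
    exacts [hg' m, hg m]
  filter_upwards [hw, hmem, h, hwhom, hs.1] with i h3 h4 h5 h6 h7
  obtain ⟨v, hv, hker⟩ := h3
  obtain ⟨a, ⟨j, hj⟩, ha, hn⟩ := h5
  choose c hc hcw using fun q => exists_isWeightedHomogeneous_aeval_eq h7 (h6 q) (h4 q)
  have hren : ∀ j, aeval (Sum.elim (y' i) (y i)) (rename Sum.inr (a j)) = aeval (y i) (a j) :=
    fun j => by rw [aeval_rename, Sum.elim_comp_inr]
  refine ⟨fun j => rename Sum.inr (a j), ⟨j, by rwa [hren]⟩, by simpa only [hren] using ha, ?_⟩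
  refine le_trans ?_ (height_comap_aeval_add_one_le_of_kernel (fun j => (he j).1)
    (fun m => (hg m).1) (c := fun l j => c (l, j)) (fun l j => hc (l, j))
    (fun l j => (hcw (l, j)).trans (hv (l, j))) hker ⟨j, hj⟩ ha)
  push_cast
  gcongr

end

theorem IsStrongFamily.jacInd {ι : Type*} {U : Ultrafilter ι} {K : ι → Type*} [∀ i, Field (K i)]
    [∀ i, PerfectField (K i)] {N : ι → ℕ} {J : Type} [Fintype J] {e : J → ℕ}
    {f : ∀ i, J → MvPolynomial (Fin (N i)) (K i)} (he : ∀ j, 0 < e j) (hf : IsStrongFamily U e f)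
    (c : ℕ) : ∀ᶠ i in U, ∀ P : Ideal (MvPolynomial (Fin (N i)) (K i)), P.IsPrime →
      P.height ≤ c → JacInd P (f i) := by
  obtain ⟨d, hd⟩ : ∃ d, ∀ j, e j ≤ d :=
    ⟨∑ j, e j, fun j => Finset.single_le_sum (fun _ _ => Nat.zero_le _) (Finset.mem_univ j)⟩
  induction d generalizing J c with
  | zero => exact .of_forall fun i P _ _ a _ j => absurd (hd j) (he j).not_ge
  | succ d ih =>
  by_contra hcon
  rw [← Ultrafilter.eventually_not] at hcon
  have h1 : ∀ᶠ i in U, ∃ P : PrimeSpectrum (MvPolynomial (Fin (N i)) (K i)),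
      P.asIdeal.height ≤ c ∧ ¬JacInd P.asIdeal (f i) := by
    filter_upwards [hcon] with i hi
    push Not at hi
    obtain ⟨P, hP, h⟩ := hi
    exact ⟨⟨P, hP⟩, h⟩
  obtain ⟨P, hP⟩ := h1.dchoice
  have key : ∀ n : ℕ,
      ∃ (M : Type) (_ : Fintype M) (g : M → ℕ) (y : ∀ i, M → MvPolynomial (Fin (N i)) (K i)),
        (∀ m, 0 < g m ∧ g m ≤ d) ∧ IsStrongFamily U g y ∧
        ∀ᶠ i in U, ∃ a : J → MvPolynomial M (K i),
          (∃ j, aeval (y i) (a j) ∉ (P i).asIdeal) ∧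
          (∀ v, ∑ j, aeval (y i) (a j) * pderiv v (f i j) ∈ (P i).asIdeal) ∧
          n ≤ ((P i).asIdeal.comap (aeval (y i) : MvPolynomial M (K i) →ₐ[K i] _)).height := by
    intro n
    induction n with
    | zero =>
      obtain ⟨M, _, g, y, hg, hy, ha⟩ :=
        exists_relation_of_not_jacInd hd hf.1 (hP.mono fun i hi => hi.2)
      refine ⟨M, _, g, y, hg, hy, ha.mono fun i hi => ?_⟩
      obtain ⟨a, h2, h3⟩ := hi
      exact ⟨a, h2, h3, by simp⟩
    | succ n ihn =>
      obtain ⟨M, _, g, y, hg, hy, ha⟩ := ihn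
      exact exists_relation_of_relation (fun j => ⟨he j, hd j⟩) hf hg hy
        (fun b => ih (fun m => (hg m).1) hy b fun m => (hg m).2) ha
  obtain ⟨M, _, g, y, hg, hy, ha⟩ := key (c + 1)
  obtain ⟨i, ⟨a, -, -, h2⟩, h3, h4⟩ :=
    (ha.and ((ih (fun m => (hg m).1) hy c fun m => (hg m).2).and hP)).exists
  have h5 := h2.trans ((h3 _ (P i).isPrime h4.1).height_comap_aeval_le.trans h4.1)
  norm_cast at h5
  omega

theorem JacInd.of_linearIndependent {K σ J J' : Type*} [Field K] [Fintype J] [Fintype J']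
    {P : Ideal (MvPolynomial σ K)} {y : J → MvPolynomial σ K} {H : J' → MvPolynomial σ K}
    {A : J' → J → K} (hA : LinearIndependent K A) (hH : ∀ j, H j = ∑ m, A j m • y m)
    (h : JacInd P y) : JacInd P H := by
  classical
  obtain ⟨B, hB⟩ := LinearMap.exists_leftInverse_of_injective
    (Fintype.linearCombination K A) (LinearMap.ker_eq_bot.2 hA.fintypeLinearCombination_injective)
  let b : J → J' → K := fun m => B fun m' => if m = m' then 1 else 0
  have hBA : ∀ j j', ∑ m, b m j' * A j m = if j' = j then 1 else 0 := by
    intro j j'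
    have h1 := congrFun (LinearMap.congr_fun hB (Pi.single j 1)) j'
    rw [LinearMap.comp_apply, Fintype.linearCombination_apply_single, one_smul,
      LinearMap.id_apply, Pi.single_apply, LinearMap.pi_apply_eq_sum_univ B (A j),
      Finset.sum_apply] at h1
    rw [← h1]
    exact Finset.sum_congr rfl fun m _ => mul_comm _ _
  intro a ha j'
  have h1 := h (fun m => ∑ j, a j * C (A j m)) fun v => by
    convert ha v using 1
    simp_rw [hH, map_sum, Derivation.map_smul, Finset.sum_mul, Finset.mul_sum, smul_eq_C_mul,
      mul_assoc]
    exact Finset.sum_comm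
  have h2 : a j' = ∑ m, C (b m j') * ∑ j, a j * C (A j m) := by
    have h3 : ∀ j, ∑ m, C (b m j') * (a j * C (A j m)) = a j * if j' = j then 1 else 0 := fun j => by
      have := congrArg (C (σ := σ)) (hBA j j')
      rw [map_sum, apply_ite C, C_0, C_1] at this
      rw [← this, Finset.mul_sum]
      exact Finset.sum_congr rfl fun m _ => by rw [C_mul]; ring
    simp_rw [Finset.mul_sum]
    rw [Finset.sum_comm]
    simp [h3]
  rw [h2]
  exact sum_mem fun m _ => Ideal.mul_mem_left _ _ (h1 m)

theorem isRnSequence_of_jacInd.{u} {K : Type u} [Field K] {N η : ℕ} {M : Type*} [Fintype M]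
    {y : M → MvPolynomial (Fin N) K} (h0 : ∀ m, constantCoeff (y m) = 0)
    (hJ : ∀ P : Ideal (MvPolynomial (Fin N) K), P.IsPrime →
      P.height ≤ (η + Fintype.card M : ℕ) → JacInd P y)
    {t : ℕ} {H : Fin t → MvPolynomial (Fin N) K}
    (hH : ∀ j, H j ∈ Submodule.span K (Set.range y)) (hli : LinearIndependent K H) :
    IsRnSequence η H := by
  simp_rw [Submodule.mem_span_range_iff_exists_fun] at hH
  choose A hA using hH
  have hAli : LinearIndependent K A := by
    rw [Fintype.linearIndependent_iff] at hli ⊢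
    intro c hc
    refine hli c ?_
    simp_rw [← hA, Finset.smul_sum, smul_smul]
    rw [Finset.sum_comm]
    refine Finset.sum_eq_zero fun m _ => ?_
    have := congrFun hc m
    simp only [Finset.sum_apply, Pi.smul_apply, smul_eq_mul, Pi.zero_apply] at this
    rw [← Finset.sum_smul, this, zero_smul]
  have ht : t ≤ Fintype.card M := by simpa using hAli.fintype_card_le_finrank
  refine ⟨fun htop => ?_, fun i hi Q hQ hQη => ?_⟩
  · have h1 : Ideal.span (Set.range H) ≤ RingHom.ker (constantCoeff : MvPolynomial (Fin N) K →+* K) := by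
      rw [Ideal.span_le]
      rintro _ ⟨j, rfl⟩
      rw [SetLike.mem_coe, RingHom.mem_ker, ← hA, map_sum]
      exact Finset.sum_eq_zero fun m _ => by
        rw [smul_eq_C_mul, map_mul, h0, mul_zero]
    rw [htop, top_le_iff] at h1
    exact RingHom.ker_ne_top _ h1
  · have himg : H '' {j : Fin t | (j : ℕ) < i} = Set.range (H ∘ Fin.castLE hi) := by
      rw [Set.range_comp, Fin.range_castLE]
    refine JacInd.isRegularLocal (f := H ∘ Fin.castLE hi) (Ideal.Quotient.mk _)
      Ideal.Quotient.mk_surjective (by rw [Ideal.mk_ker, himg]) Q ?_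
    refine ((hJ _ (Ideal.comap_isPrime _ _) ?_).of_linearIndependent hAli
      fun j => (hA j).symm).comp_injective (Fin.castLE_injective hi)
    refine (Ideal.height_comap_le_of_surjective Ideal.Quotient.mk_surjective Q).trans ?_
    push_cast
    refine add_le_add ?_ ?_
    · exact (PrimeSpectrum.height_eq_orderHeight ⟨Q, hQ⟩).le.trans hQη
    · rw [Ideal.mk_ker, himg]
      have h2 : (Set.range (H ∘ Fin.castLE hi)).ncard ≤ i := by
        rw [← Set.image_univ]
        exact (Set.ncard_image_le (Set.toFinite _)).trans (by simp)
      have h3 := Submodule.spanFinrank_span_le_ncard_of_finite (R := MvPolynomial (Fin N) K)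
        (Set.finite_range (H ∘ Fin.castLE hi))
      exact_mod_cast (h3.trans h2).trans (hi.trans ht)

universe u

/-- For every positive `η` there is a positive-integer-valued function `ηB` of
dimension sequences `δ ∈ ℕ^d`, independent of `N` and `K`, such that every graded subspace
`V = V_1 ⊕ ⋯ ⊕ V_d` of `K[x_1, …, x_N]` (`K` algebraically closed) with dimension sequence `δ`
is contained in the `K`-subalgebra generated by forms `G_1, …, G_s` of positive degree at most
`d` with `s ≤ ηB δ`, such that moreover every sequence of `K`-linearly independent forms lying
in the `K`-span of `G_1, …, G_s` is an `R_η`-sequence. -/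
theorem statement5 (η : ℕ) (hη : 0 < η) (d : ℕ) :
    ∃ B : (Fin d → ℕ) → ℕ, (∀ δ, 0 < B δ) ∧
      ∀ (K : Type u) [Field K] [IsAlgClosed K] (N : ℕ)
        (V : Fin d → Submodule K (MvPolynomial (Fin N) K)),
        (∀ i, V i ≤ homogeneousSubmodule (Fin N) K ((i : ℕ) + 1)) →
        (∀ i, FiniteDimensional K (V i)) →
        ∃ (s : ℕ) (G : Fin s → MvPolynomial (Fin N) K),
          s ≤ B (fun i => Module.finrank K (V i)) ∧
          (∀ j, ∃ e : ℕ, 0 < e ∧ e ≤ d ∧ (G j).IsHomogeneous e) ∧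
          (∀ F ∈ (⨆ i, V i : Submodule K (MvPolynomial (Fin N) K)),
            F ∈ Algebra.adjoin K (Set.range G)) ∧
          ∀ (t : ℕ) (H : Fin t → MvPolynomial (Fin N) K),
            (∀ j, H j ∈ Submodule.span K (Set.range G) ∧ ∃ e : ℕ, (H j).IsHomogeneous e) →
            LinearIndependent K H →
            IsRnSequence η H := by
  classical
  suffices h : ∀ δ : Fin d → ℕ, ∃ b : ℕ, ∀ (K : Type u) [Field K] [IsAlgClosed K] (N : ℕ)
      (V : Fin d → Submodule K (MvPolynomial (Fin N) K)),
      (∀ i, V i ≤ homogeneousSubmodule (Fin N) K ((i : ℕ) + 1)) →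
      (∀ i, FiniteDimensional K (V i)) → (fun i => Module.finrank K (V i)) = δ →
      ∃ (s : ℕ) (G : Fin s → MvPolynomial (Fin N) K),
        s ≤ b ∧
        (∀ j, ∃ e : ℕ, 0 < e ∧ e ≤ d ∧ (G j).IsHomogeneous e) ∧
        (∀ F ∈ (⨆ i, V i : Submodule K (MvPolynomial (Fin N) K)),
          F ∈ Algebra.adjoin K (Set.range G)) ∧
        ∀ (t : ℕ) (H : Fin t → MvPolynomial (Fin N) K),
          (∀ j, H j ∈ Submodule.span K (Set.range G) ∧ ∃ e : ℕ, (H j).IsHomogeneous e) →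
          LinearIndependent K H → IsRnSequence η H by
    choose B hB using h
    refine ⟨fun δ => B δ + 1, fun δ => Nat.succ_pos _, fun K _ _ N V hV hfin => ?_⟩
    obtain ⟨s, G, hs, h⟩ := hB _ K N V hV hfin rfl
    exact ⟨s, G, hs.trans (Nat.le_succ _), h⟩
  intro δ
  by_contra hcon
  push Not at hcon
  choose K hK hKa N V hV hfin hδ hbad using hcon
  let w : ∀ b, (Σ i : Fin d, Fin (δ i)) → MvPolynomial (Fin (N b)) (K b) := fun b q =>
    Module.finBasisOfFinrankEq (K b) (V b q.1) (congrFun (hδ b) q.1) q.2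
  obtain ⟨M, _, g, y, hg, hy, hmem⟩ := exists_isStrongFamily (U := Filter.hyperfilter ℕ) (w := w) d
    (a := fun q => q.1 + 1) (fun q => q.1.2) (.of_forall fun b q => hV b q.1
      (Module.finBasisOfFinrankEq (K b) (V b q.1) (congrFun (hδ b) q.1) q.2).2)
  have hlarge : ∀ᶠ b in (Filter.hyperfilter ℕ : Filter ℕ), Fintype.card M ≤ b :=
    (Filter.eventually_ge_atTop _).filter_mono Nat.hyperfilter_le_atTop
  obtain ⟨b, h1, h2, h3, h4⟩ := (hlarge.and (hmem.and (hy.1.and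
    (hy.jacInd (fun m => (hg m).1) (η + Fintype.card M))))).exists
  let f := (Fintype.equivFin M).symm
  have hrange : Set.range (y b ∘ f) = Set.range (y b) := f.surjective.range_comp _
  obtain ⟨t, H, hH, hli, hR⟩ := hbad b (Fintype.card M) (y b ∘ f) h1
    (fun j => ⟨g (f j), (hg _).1, (hg _).2, h3 _⟩) (by
      rw [hrange]
      change (⨆ i, V b i) ≤ Subalgebra.toSubmodule (Algebra.adjoin (K b) (Set.range (y b)))
      refine iSup_le fun i F hF => ?_
      have h5 := congrArg Subtype.val ((Module.finBasisOfFinrankEq (K b) (V b i)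
        (congrFun (hδ b) i)).sum_repr ⟨F, hF⟩)
      rw [← show _ = F from h5, Submodule.coe_sum]
      exact sum_mem fun k _ => Submodule.smul_mem _ _ (h2 ⟨i, k⟩))
  refine hR (isRnSequence_of_jacInd (fun m => ?_) h4 (fun j => ?_) hli)
  · rw [constantCoeff_eq]
    exact (h3 m).coeff_eq_zero (by simpa using (hg m).1.ne)
  · rw [← hrange]
    exact (hH j).1
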